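/- Let X be a conjugacy class of involutions in G_n with labelled cycle type (1,k_e,2,0), where m = 1, l = 0, k_o = 2 and k_e ≥ 3. Then C(G_n,X) is connected with diameter at most n+1. -/

import Mathlib

/-!
Common setup: the affine Weyl group of type C̃ₙ, realized as the semidirect
product of the group Wₙ of signed permutations of {1,…,n} with the translation
lattice ℤⁿ.  An element is a triple `(π, s, v)`, where `π` is the underlying
permutation of the n points, `s i` is the sign attached to the point `i`
(so the signed permutation maps the point `i` to the point `π i` with sign `s i`),
and `v ∈ ℤⁿ` is the translation part.  The multiplication realizes
`(α,v)(τ,u) = (ατ, vᵗ + u)`.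
-/

/-- An element of the affine Weyl group of type C̃ₙ: a signed permutation
`(π, s)` together with a translation vector `v ∈ ℤⁿ`. -/
@[ext]
structure AffineWeylC (n : ℕ) where
  π : Equiv.Perm (Fin n)
  s : Fin n → ℤˣ
  v : Fin n → ℤ

namespace AffineWeylC

variable {n : ℕ}

instance : One (AffineWeylC n) := ⟨⟨1, 1, 0⟩⟩

instance : Mul (AffineWeylC n) :=
  ⟨fun g h => ⟨h.π * g.π, fun j => g.s j * h.s (g.π j),
    fun i => (h.s (h.π⁻¹ i) : ℤ) * g.v (h.π⁻¹ i) + h.v i⟩⟩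

instance : Inv (AffineWeylC n) :=
  ⟨fun g => ⟨g.π⁻¹, fun k => (g.s (g.π⁻¹ k))⁻¹,
    fun i => -(((g.s i)⁻¹ : ℤˣ) : ℤ) * g.v (g.π i)⟩⟩

@[simp] lemma mul_π (g h : AffineWeylC n) : (g * h).π = h.π * g.π := rfl
@[simp] lemma mul_s (g h : AffineWeylC n) (j : Fin n) :
    (g * h).s j = g.s j * h.s (g.π j) := rfl
@[simp] lemma mul_v (g h : AffineWeylC n) (i : Fin n) :
    (g * h).v i = (h.s (h.π⁻¹ i) : ℤ) * g.v (h.π⁻¹ i) + h.v i := rfl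
@[simp] lemma one_π : (1 : AffineWeylC n).π = 1 := rfl
@[simp] lemma one_s (j : Fin n) : (1 : AffineWeylC n).s j = 1 := rfl
@[simp] lemma one_v (i : Fin n) : (1 : AffineWeylC n).v i = 0 := rfl
@[simp] lemma inv_π (g : AffineWeylC n) : g⁻¹.π = g.π⁻¹ := rfl
@[simp] lemma inv_s (g : AffineWeylC n) (k : Fin n) :
    g⁻¹.s k = (g.s (g.π⁻¹ k))⁻¹ := rfl
@[simp] lemma inv_v (g : AffineWeylC n) (i : Fin n) :
    g⁻¹.v i = -(((g.s i)⁻¹ : ℤˣ) : ℤ) * g.v (g.π i) := rfl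

instance : Group (AffineWeylC n) where
  mul_assoc a b c := by
    refine AffineWeylC.ext ?_ (funext fun j => ?_) (funext fun i => ?_)
    · simp [mul_assoc]
    · simp only [mul_s, mul_π, Equiv.Perm.mul_apply]
      rw [mul_assoc]
    · simp only [mul_v, mul_s, mul_π, mul_inv_rev, Equiv.Perm.mul_apply,
        show ∀ (σ : Equiv.Perm (Fin n)) (x : Fin n), σ (σ⁻¹ x) = x from
          fun σ x => σ.apply_symm_apply x, Units.val_mul]
      ring
  one_mul a := by
    refine AffineWeylC.ext ?_ (funext fun j => ?_) (funext fun i => ?_) <;>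
      simp
  mul_one a := by
    refine AffineWeylC.ext ?_ (funext fun j => ?_) (funext fun i => ?_) <;>
      simp
  inv_mul_cancel a := by
    refine AffineWeylC.ext ?_ (funext fun j => ?_) (funext fun i => ?_)
    · simp
    · simp
    · simp only [mul_v, inv_v, inv_s, one_v,
        show ∀ (σ : Equiv.Perm (Fin n)) (x : Fin n), σ (σ⁻¹ x) = x from
          fun σ x => σ.apply_symm_apply x]
      have h1 : ((a.s (a.π⁻¹ i) : ℤ)) * (((a.s (a.π⁻¹ i))⁻¹ : ℤˣ) : ℤ) = 1 := by
        rw [← Units.val_mul, mul_inv_cancel, Units.val_one]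
      linear_combination (-(a.v i)) * h1

/-- `g` is an involution: a non-identity element squaring to the identity. -/
def Involution (g : AffineWeylC n) : Prop := g ≠ 1 ∧ g * g = 1

/-- The conjugacy class of `a`. -/
def conjClass (a : AffineWeylC n) : Set (AffineWeylC n) := {b | IsConj a b}

/-- The number of transpositions (2-cycles) of the underlying signed permutation. -/
noncomputable def numTrans (g : AffineWeylC n) : ℕ :=
  {i : Fin n | g.π i ≠ i}.ncard / 2

/-- The number of negative 1-cycles of `g` carrying an even label. -/
noncomputable def numNegEven (g : AffineWeylC n) : ℕ :=
  {i : Fin n | g.π i = i ∧ g.s i = -1 ∧ Even (g.v i)}.ncard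

/-- The number of negative 1-cycles of `g` carrying an odd label. -/
noncomputable def numNegOdd (g : AffineWeylC n) : ℕ :=
  {i : Fin n | g.π i = i ∧ g.s i = -1 ∧ Odd (g.v i)}.ncard

/-- The number of positive 1-cycles (fixed points) of `g`. -/
noncomputable def numPos (g : AffineWeylC n) : ℕ :=
  {i : Fin n | g.π i = i ∧ g.s i = 1}.ncard

/-- The labelled cycle type `(m, k_e, k_o, l)` of an involution. -/
noncomputable def cycleType (g : AffineWeylC n) : ℕ × ℕ × ℕ × ℕ :=
  (numTrans g, numNegEven g, numNegOdd g, numPos g)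

/-- `g` has labelled cycle type `(m, k_e, k_o, l)`. -/
def HasType (g : AffineWeylC n) (m ke ko l : ℕ) : Prop :=
  numTrans g = m ∧ numNegEven g = ke ∧ numNegOdd g = ko ∧ numPos g = l

/-- The canonical class representative
`a_{m,k_e,k_o,l} = (1 2)⁺₀ ⋯ (2m−1 2m)⁺₀ (2m+1)⁻₀ ⋯ (2m+k_e)⁻₀
(2m+k_e+1)⁻₁ ⋯ (n−l)⁻₁ (n−l+1)⁺₀ ⋯ (n)⁺₀`
(here written with 0-based indices): points `0,…,2m-1` are paired off into
label‑0 positive transpositions, points `2m,…,2m+k_e-1` are negative 1-cycles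
with label 0, points `2m+k_e,…,2m+k_e+k_o-1` are negative 1-cycles with label 1,
and the remaining `l` points are positive fixed points with label 0. -/
def IsCanon (a : AffineWeylC n) (m ke ko l : ℕ) : Prop :=
  2*m + ke + ko + l = n ∧
  (∀ i : Fin n, i.val < 2*m → i.val % 2 = 0 → (a.π i).val = i.val + 1) ∧
  (∀ i : Fin n, i.val < 2*m → i.val % 2 = 1 → (a.π i).val = i.val - 1) ∧
  (∀ i : Fin n, 2*m ≤ i.val → a.π i = i) ∧
  (∀ i : Fin n, i.val < 2*m → a.s i = 1 ∧ a.v i = 0) ∧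
  (∀ i : Fin n, 2*m ≤ i.val → i.val < 2*m + ke → a.s i = -1 ∧ a.v i = 0) ∧
  (∀ i : Fin n, 2*m + ke ≤ i.val → i.val < 2*m + ke + ko → a.s i = -1 ∧ a.v i = 1) ∧
  (∀ i : Fin n, 2*m + ke + ko ≤ i.val → a.s i = 1 ∧ a.v i = 0)

/-- The labelled positive transposition `(α β)⁺_λ`. -/
def posTrans (α β : Fin n) (lam : ℤ) : AffineWeylC n :=
  ⟨Equiv.swap α β, 1, fun i => if i = α then lam else if i = β then -lam else 0⟩

/-- The labelled negative transposition `(α β)⁻_λ`. -/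
def negTrans (α β : Fin n) (lam : ℤ) : AffineWeylC n :=
  ⟨Equiv.swap α β, fun i => if i = α then -1 else if i = β then -1 else 1,
    fun i => if i = α then lam else if i = β then lam else 0⟩

/-- The labelled negative 1-cycle `(α)⁻_λ`. -/
def negOne (α : Fin n) (lam : ℤ) : AffineWeylC n :=
  ⟨1, fun i => if i = α then -1 else 1, fun i => if i = α then lam else 0⟩

/-- The finite Weyl group Wₙ of type Cₙ, as the subgroup of the affine Weyl
group consisting of the elements with trivial translation part. -/
def WeylSub (n : ℕ) : Subgroup (AffineWeylC n) where
  carrier := {g | g.v = 0}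
  one_mem' := rfl
  mul_mem' := by
    intro g h hg hh
    show (g * h).v = 0
    funext i
    simp only [mul_v]
    rw [show g.v = 0 from hg, show h.v = 0 from hh]
    simp
  inv_mem' := by
    intro g hg
    show g⁻¹.v = 0
    funext i
    simp only [inv_v]
    rw [show g.v = 0 from hg]
    simp

/-- The projection `G_n → W_n`, `(σ, v) ↦ σ`. -/
def weylPart (n : ℕ) : AffineWeylC n →* WeylSub n where
  toFun g := ⟨⟨g.π, g.s, 0⟩, rfl⟩
  map_one' := by
    apply Subtype.ext
    refine AffineWeylC.ext rfl rfl rfl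
  map_mul' g h := by
    apply Subtype.ext
    refine AffineWeylC.ext rfl rfl (funext fun i => ?_)
    simp

end AffineWeylC

/-- The commuting graph on a subset `X` of a group: the vertices are the
elements of `X`, and distinct vertices are adjacent iff they commute. -/
def commGraph {G : Type*} [Group G] (X : Set G) : SimpleGraph X where
  Adj x y := (x : G) ≠ (y : G) ∧ Commute (x : G) (y : G)
  symm := ⟨fun _ _ h => ⟨fun e => h.1 e.symm, h.2.symm⟩⟩
  loopless := ⟨fun _ h => h.1 rfl⟩

namespace AffineWeylC

variable {n : ℕ}

/-- The involution acting as the transposition of `α` and `β` with sign `ε` and as `-1` on all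
other coordinates, whose fixed line passes through the point `f / 2`. -/
def line (α β : Fin n) (ε : ℤˣ) (f : Fin n → ℤ) : AffineWeylC n :=
  ⟨Equiv.swap α β, fun i => if i = α ∨ i = β then ε else -1,
    fun i => (f i - ((if i = α ∨ i = β then ε else -1 : ℤˣ) : ℤ) * f (Equiv.swap α β i)) / 2⟩

/-- The parity conditions under which `line α β ε f` has exactly two odd negative 1-cycles,
at `o₁` and `o₂`. -/
def IsFrame (α β o₁ o₂ : Fin n) (f : Fin n → ℤ) : Prop :=
  (α ≠ β ∧ α ≠ o₁ ∧ α ≠ o₂ ∧ β ≠ o₁ ∧ β ≠ o₂ ∧ o₁ ≠ o₂) ∧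
  (∀ i, i ≠ α → i ≠ β → (f i % 2 = 1 ↔ (i = o₁ ∨ i = o₂))) ∧ f α % 2 = f β % 2

/-- A frame all of whose odd coordinates are `o₁` and `o₂`. -/
def IsEvenFrame (α β o₁ o₂ : Fin n) (f : Fin n → ℤ) : Prop :=
  (α ≠ β ∧ α ≠ o₁ ∧ α ≠ o₂ ∧ β ≠ o₁ ∧ β ≠ o₂ ∧ o₁ ≠ o₂) ∧
  (∀ i, f i % 2 = 1 ↔ (i = o₁ ∨ i = o₂))

lemma IsEvenFrame.isFrame {α β o₁ o₂ : Fin n} {f : Fin n → ℤ} (h : IsEvenFrame α β o₁ o₂ f) :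
    IsFrame α β o₁ o₂ f := by
  grind [IsEvenFrame, IsFrame]

lemma units_mul_parity (ε : ℤˣ) (x : ℤ) : ((ε : ℤ) * x) % 2 = x % 2 := by
  rcases Int.units_eq_one_or ε with rfl | rfl <;> simp

lemma two_mul_line_v {α β o₁ o₂ : Fin n} {f : Fin n → ℤ} (h : IsFrame α β o₁ o₂ f) (ε : ℤˣ)
    (i : Fin n) : 2 * (line α β ε f).v i =
      f i - (((line α β ε f).s i : ℤˣ) : ℤ) * f ((line α β ε f).π i) := by
  simp only [line]
  apply Int.mul_ediv_cancel'
  have h1 := units_mul_parity (if i = α ∨ i = β then ε else -1) (f (Equiv.swap α β i))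
  have h2 : f (Equiv.swap α β i) % 2 = f i % 2 := by
    rw [Equiv.swap_apply_def]
    grind [IsFrame]
  omega

lemma line_comm (α β : Fin n) (ε : ℤˣ) (f : Fin n → ℤ) : line α β ε f = line β α ε f := by
  unfold line
  simp [Equiv.swap_comm α β, or_comm]

lemma line_congr {α β : Fin n} (ε : ℤˣ) {f f' : Fin n → ℤ}
    (h : ∀ i, i ≠ α → i ≠ β → f i = f' i) (h' : f α - ε * f β = f' α - ε * f' β) :
    line α β ε f = line α β ε f' := by
  unfold line
  refine AffineWeylC.ext rfl rfl (funext fun i => ?_)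
  dsimp only
  congr 1
  by_cases hα : i = α
  · subst hα; simpa using h'
  by_cases hβ : i = β
  · subst hβ
    rcases Int.units_eq_one_or ε with rfl | rfl <;> simp at h' ⊢ <;> linarith
  simp [hα, hβ, Equiv.swap_apply_of_ne_of_ne, h i hα hβ]

/-- Sliding the base point along the fixed line to a prescribed value at `α`. -/
lemma exists_line_eq {α β : Fin n} (hαβ : α ≠ β) (ε : ℤˣ) (f : Fin n → ℤ) (z : ℤ) :
    ∃ f', line α β ε f = line α β ε f' ∧ f' α = z ∧
      (f' β - f β - (f' α - f α)) % 2 = 0 ∧ ∀ i, i ≠ α → i ≠ β → f' i = f i := by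
  refine ⟨fun i => if i = α then z else if i = β then f β + ε * (z - f α) else f i, ?_, by simp,
    ?_, fun i h1 h2 => by simp [h1, h2]⟩
  · apply line_congr
    · intro i h1 h2; simp [h1, h2]
    · rcases Int.units_eq_one_or ε with rfl | rfl <;> simp [hαβ.symm] <;> ring
  · have := units_mul_parity ε (z - f α)
    simp only [hαβ.symm, if_true, if_false]
    omega

lemma line_s_swap (α β : Fin n) (ε : ℤˣ) (f : Fin n → ℤ) (i : Fin n) :
    (line α β ε f).s (Equiv.swap α β i) = (line α β ε f).s i := by
  simp only [line, Equiv.swap_apply_def]; grind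

lemma commute_of_disjoint {α β o₁ o₂ γ δ u₁ u₂ : Fin n} {f : Fin n → ℤ} (ε σ : ℤˣ)
    (h : IsFrame α β o₁ o₂ f) (h' : IsFrame γ δ u₁ u₂ f)
    (hd : α ≠ γ ∧ α ≠ δ ∧ β ≠ γ ∧ β ≠ δ) :
    Commute (line α β ε f) (line γ δ σ f) := by
  obtain ⟨h1, h2, h3, h4⟩ := hd
  have hs : ∀ i, (line α β ε f).s (Equiv.swap γ δ i) = (line α β ε f).s i := by
    intro i; simp only [line, Equiv.swap_apply_def]; grind
  have hs' : ∀ i, (line γ δ σ f).s (Equiv.swap α β i) = (line γ δ σ f).s i := by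
    intro i; simp only [line, Equiv.swap_apply_def]; grind
  have hc : ∀ i, Equiv.swap α β (Equiv.swap γ δ i) = Equiv.swap γ δ (Equiv.swap α β i) := by
    intro i; simp only [Equiv.swap_apply_def]; grind
  have e1 : (line α β ε f).π = Equiv.swap α β := rfl
  have e2 : (line γ δ σ f).π = Equiv.swap γ δ := rfl
  refine AffineWeylC.ext (Equiv.ext fun i => ?_) (funext fun i => ?_) (funext fun i => ?_)
  · simp [e1, e2, hc]
  · simp [e1, e2, hs, hs', mul_comm]
  · have k1 := two_mul_line_v h ε
    have k2 := two_mul_line_v h' σ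
    have : 2 * (line α β ε f * line γ δ σ f).v i = 2 * (line γ δ σ f * line α β ε f).v i := by
      simp only [mul_v, mul_add, e1, e2, Equiv.swap_inv]
      rw [mul_left_comm, k1, mul_left_comm 2, k2, k1, k2]
      simp only [e1, e2, hs, hs', hc, line_s_swap]
      ring
    linarith

lemma commute_flip {α β o₁ o₂ : Fin n} {f f' : Fin n → ℤ} (ε : ℤˣ)
    (h : IsFrame α β o₁ o₂ f) (h' : IsFrame α β o₁ o₂ f')
    (hff : ∀ i, i ≠ α → i ≠ β → f i = f' i) :
    Commute (line α β ε f) (line α β (-ε) f') := by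
  have hss : ∀ i, ((line α β ε f).s i : ℤ) - (line α β (-ε) f').s i =
      if i = α ∨ i = β then 2 * (ε : ℤ) else 0 := by
    intro i; simp only [line]; split_ifs <;> simp; ring
  refine AffineWeylC.ext rfl (funext fun i => ?_) (funext fun i => ?_)
  · simp only [mul_s]
    have e : ∀ σ g, (line α β σ g).π = Equiv.swap α β := fun _ _ => rfl
    simp only [e, line_s_swap, mul_comm]
  · have k1 := two_mul_line_v h ε
    have k2 := two_mul_line_v h' (-ε)
    have e : ∀ σ g, (line α β σ g).π = Equiv.swap α β := fun _ _ => rfl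
    have : 2 * (line α β ε f * line α β (-ε) f').v i =
        2 * (line α β (-ε) f' * line α β ε f).v i := by
      simp only [mul_v, mul_add, e, Equiv.swap_inv]
      rw [mul_left_comm, k1, mul_left_comm 2, k2, k1, k2]
      simp only [e, line_s_swap, Equiv.swap_apply_self]
      have a1 := hss i
      by_cases hi : i = α ∨ i = β
      · simp only [hi, if_true] at a1
        have : ((line α β (-ε) f').s i : ℤ) = (line α β ε f).s i - 2 * ε := by linarith
        have h3 : ((line α β ε f).s i : ℤ) = ε := by simp [line, hi]
        rw [this, h3]
        have h4 : (ε : ℤ) * ε = 1 := Int.units_coe_mul_self ε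
        linear_combination (f i - f' i) * h4
      · push Not at hi
        have := hff i hi.1 hi.2
        rw [Equiv.swap_apply_of_ne_of_ne hi.1 hi.2, this]
        ring
    linarith

/-- The involutions `line α β ε f` with exactly two odd negative 1-cycles. -/
def lineSet (n : ℕ) : Set (AffineWeylC n) :=
  {g | ∃ α β o₁ o₂ ε f, IsFrame α β o₁ o₂ f ∧ g = line α β ε f}

/-- `x` and `y` lie at distance at most `k` in the commuting graph on `lineSet n`. -/
def Near (k : ℕ) (x y : AffineWeylC n) : Prop :=
  ∃ (hx : x ∈ lineSet n) (hy : y ∈ lineSet n),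
    (commGraph (lineSet n)).edist ⟨x, hx⟩ ⟨y, hy⟩ ≤ k

lemma Near.trans {j k : ℕ} {x y z : AffineWeylC n} (h : Near j x y) (h' : Near k y z) :
    Near (j + k) x z := by
  obtain ⟨hx, hy, h⟩ := h
  obtain ⟨_, hz, h'⟩ := h'
  refine ⟨hx, hz, ((commGraph (lineSet n)).edist_triangle (v := ⟨y, hy⟩)).trans ?_⟩
  push_cast
  exact add_le_add h h'

lemma Near.symm {k : ℕ} {x y : AffineWeylC n} (h : Near k x y) : Near k y x := by
  obtain ⟨hx, hy, h⟩ := h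
  exact ⟨hy, hx, by rwa [SimpleGraph.edist_comm]⟩

lemma Near.mono {j k : ℕ} {x y : AffineWeylC n} (h : Near j x y) (hjk : j ≤ k) : Near k x y := by
  obtain ⟨hx, hy, h⟩ := h
  exact ⟨hx, hy, h.trans (by exact_mod_cast hjk)⟩

lemma near_of_commute {x y : AffineWeylC n} (hx : x ∈ lineSet n) (hy : y ∈ lineSet n)
    (h : Commute x y) : Near 1 x y := by
  refine ⟨hx, hy, ?_⟩
  rw [Nat.cast_one, SimpleGraph.edist_le_one_iff_adj_or_eq]
  by_cases e : x = y
  · right; exact Subtype.ext e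
  · left; exact ⟨e, h⟩

/-- Moving to a line with disjoint transposition through the same point. -/
lemma near_hop {α β o₁ o₂ γ δ u₁ u₂ : Fin n} {f : Fin n → ℤ} (ε σ : ℤˣ)
    (h : IsFrame α β o₁ o₂ f) (h' : IsFrame γ δ u₁ u₂ f)
    (hd : α ≠ γ ∧ α ≠ δ ∧ β ≠ γ ∧ β ≠ δ) : Near 1 (line α β ε f) (line γ δ σ f) :=
  near_of_commute ⟨_, _, _, _, _, _, h, rfl⟩ ⟨_, _, _, _, _, _, h', rfl⟩
    (commute_of_disjoint ε σ h h' hd)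

/-- Flipping the sign of the transposition, with arbitrary new values on it. -/
lemma near_flip {α β o₁ o₂ : Fin n} {f f' : Fin n → ℤ} (ε : ℤˣ)
    (h : IsFrame α β o₁ o₂ f) (h' : IsFrame α β o₁ o₂ f')
    (hff : ∀ i, i ≠ α → i ≠ β → f i = f' i) : Near 1 (line α β ε f) (line α β (-ε) f') :=
  near_of_commute ⟨_, _, _, _, _, _, h, rfl⟩ ⟨_, _, _, _, _, _, h', rfl⟩
    (commute_flip ε h h' hff)

lemma conj_line {α β o₁ o₂ : Fin n} {f f' : Fin n → ℤ} (c : AffineWeylC n) (ε ε' : ℤˣ)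
    (h : IsFrame (c.π α) (c.π β) (c.π o₁) (c.π o₂) f) (h' : IsFrame α β o₁ o₂ f')
    (hf : ∀ i, f (c.π i) = c.s i * f' i + 2 * c.v (c.π i)) (hε : ε = ε' * c.s α * c.s β) :
    c * line (c.π α) (c.π β) ε f = line α β ε' f' * c := by
  have e : ∀ γ δ σ g, (line γ δ σ g : AffineWeylC n).π = Equiv.swap γ δ := fun _ _ _ _ => rfl
  have hsw : ∀ i, Equiv.swap (c.π α) (c.π β) (c.π i) = c.π (Equiv.swap α β i) := by
    intro i; exact (Equiv.swap_apply_apply c.π α β ▸ by simp)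
  have hu : ∀ u : ℤˣ, u * u = 1 := fun u => Int.units_mul_self u
  have hS : ∀ i, c.s i * (line (c.π α) (c.π β) ε f).s (c.π i) =
      (line α β ε' f').s i * c.s (Equiv.swap α β i) := by
    intro i
    simp only [line, EmbeddingLike.apply_eq_iff_eq, hε]
    by_cases h1 : i = α
    · subst h1
      simp only [true_or, if_true, Equiv.swap_apply_left]
      rw [mul_comm ε', mul_assoc, ← mul_assoc, hu, one_mul]
    by_cases h2 : i = β
    · subst h2
      simp only [or_true, if_true, Equiv.swap_apply_right]
      rw [mul_comm (ε' * _), ← mul_assoc, hu, one_mul]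
    simp [h1, h2, Equiv.swap_apply_of_ne_of_ne]
  refine AffineWeylC.ext (Equiv.ext fun i => ?_) (funext fun i => ?_) (funext fun i => ?_)
  · simp [e, hsw]
  · simp [e, hS]
  · obtain ⟨i, rfl⟩ := c.π.surjective i
    have hinv : ∀ i, c.π⁻¹ (c.π i) = i := fun i => c.π.symm_apply_apply i
    have k1 := two_mul_line_v h ε (c.π i)
    have k2 := two_mul_line_v h' ε' i
    have : 2 * (c * line (c.π α) (c.π β) ε f).v (c.π i) =
        2 * (line α β ε' f' * c).v (c.π i) := by
      simp only [mul_v, mul_add, e, Equiv.swap_inv, hsw, hinv]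
      rw [k1, mul_left_comm 2 (c.s i : ℤ), k2]
      simp only [e, hsw, hf]
      have e1 := congrArg (Units.val) (hS i)
      have e2 := congrArg (Units.val) (hS (Equiv.swap α β i))
      have e3 : (line (c.π α) (c.π β) ε f).s (c.π (Equiv.swap α β i)) =
          (line (c.π α) (c.π β) ε f).s (c.π i) := by
        rw [← hsw, line_s_swap]
      rw [e3, line_s_swap, Equiv.swap_apply_self] at e2
      rw [e3]
      push_cast at e1 e2
      linear_combination (-f' (Equiv.swap α β i)) * e2
    linarith

lemma exists_perm_of_ne {a b c d a' b' c' d' : Fin n}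
    (h : a ≠ b ∧ a ≠ c ∧ a ≠ d ∧ b ≠ c ∧ b ≠ d ∧ c ≠ d)
    (h' : a' ≠ b' ∧ a' ≠ c' ∧ a' ≠ d' ∧ b' ≠ c' ∧ b' ≠ d' ∧ c' ≠ d') :
    ∃ p : Equiv.Perm (Fin n), p a = a' ∧ p b = b' ∧ p c = c' ∧ p d = d' := by
  have inj : ∀ {a b c d : Fin n}, (a ≠ b ∧ a ≠ c ∧ a ≠ d ∧ b ≠ c ∧ b ≠ d ∧ c ≠ d) →
      Function.Injective ![a, b, c, d] := by
    intro a b c d h i j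
    fin_cases i <;> fin_cases j <;> simp <;> grind
  have ht : MulAction.IsMultiplyPretransitive (Equiv.Perm (Fin n)) (Fin n) 4 :=
    Equiv.Perm.isMultiplyPretransitive _ _
  obtain ⟨p, hp⟩ := MulAction.isMultiplyPretransitive_iff.mp ht ⟨_, inj h⟩ ⟨_, inj h'⟩
  have key := fun i => DFunLike.congr_fun hp i
  exact ⟨p, by simpa using key 0, by simpa using key 1, by simpa using key 2, by simpa using key 3⟩

lemma IsFrame.exists_even {α β o₁ o₂ : Fin n} {f : Fin n → ℤ} (h : IsFrame α β o₁ o₂ f)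
    (ε : ℤˣ) : ∃ f', IsEvenFrame α β o₁ o₂ f' ∧ line α β ε f = line α β ε f' := by
  obtain ⟨f', h1, h2, h3, h4⟩ := exists_line_eq h.1.1 ε f 0
  refine ⟨f', ⟨h.1, fun i => ?_⟩, h1⟩
  obtain ⟨hd, hp, hq⟩ := h
  by_cases hα : i = α
  · subst hα; grind
  by_cases hβ : i = β
  · subst hβ; grind
  grind

lemma isConj_line {α β o₁ o₂ γ δ u₁ u₂ : Fin n} {f f' : Fin n → ℤ} (ε ε' : ℤˣ)
    (h : IsEvenFrame γ δ u₁ u₂ f) (h' : IsEvenFrame α β o₁ o₂ f') :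
    IsConj (line γ δ ε f) (line α β ε' f') := by
  obtain ⟨p, rfl, rfl, rfl, rfl⟩ := exists_perm_of_ne h'.1 h.1
  let s : Fin n → ℤˣ := fun i => if i = α then ε * ε' else 1
  let c : AffineWeylC n := ⟨p, s, fun j => (f j - (s (p⁻¹ j) : ℤ) * f' (p⁻¹ j)) / 2⟩
  have hinv : ∀ i, p⁻¹ (p i) = i := fun i => p.symm_apply_apply i
  have hu : ∀ u : ℤˣ, u * u = 1 := fun u => Int.units_mul_self u
  rw [isConj_iff]
  refine ⟨c, ?_⟩
  rw [mul_inv_eq_iff_eq_mul]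
  refine conj_line c ε ε' h.isFrame h'.isFrame (fun i => ?_) ?_
  · have e : c.v (p i) = (f (p i) - (s i : ℤ) * f' i) / 2 := by simp only [c, hinv]
    change f (p i) = (s i : ℤ) * f' i + 2 * c.v (p i)
    rw [e, Int.mul_ediv_cancel']
    · ring
    · have h1 := units_mul_parity (s i) (f' i)
      have h2 := h.2 (p i)
      have h3 := h'.2 i
      simp only [EmbeddingLike.apply_eq_iff_eq] at h2
      rw [← h3] at h2
      omega
  · have hβ : s β = 1 := by simp [s, h'.1.1.symm]
    have hα : s α = ε * ε' := by simp [s]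
    change ε = ε' * s α * s β
    rw [hα, hβ, mul_one, mul_comm ε, ← mul_assoc, hu, one_mul]

lemma conj_mem_lineSet {x b : AffineWeylC n} (hx : x ∈ lineSet n) (h : IsConj x b) :
    b ∈ lineSet n := by
  obtain ⟨c, rfl⟩ := isConj_iff.mp h
  obtain ⟨γ, δ, u₁, u₂, ε, f, hf, rfl⟩ := hx
  obtain ⟨α, rfl⟩ := c.π.surjective γ
  obtain ⟨β, rfl⟩ := c.π.surjective δ
  obtain ⟨o₁, rfl⟩ := c.π.surjective u₁
  obtain ⟨o₂, rfl⟩ := c.π.surjective u₂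
  let f' : Fin n → ℤ := fun i => (c.s i : ℤ) * (f (c.π i) - 2 * c.v (c.π i))
  have hu : ∀ u : ℤˣ, u * u = 1 := fun u => Int.units_mul_self u
  have hp : ∀ i, f' i % 2 = f (c.π i) % 2 := by
    intro i
    have := units_mul_parity (c.s i) (f (c.π i) - 2 * c.v (c.π i))
    simp only [f']
    omega
  have hf' : IsFrame α β o₁ o₂ f' := by
    refine ⟨?_, fun i h1 h2 => ?_, ?_⟩
    · have := hf.1
      simpa only [ne_eq, EmbeddingLike.apply_eq_iff_eq] using this
    · have := hf.2.1 (c.π i)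
      simp only [ne_eq, EmbeddingLike.apply_eq_iff_eq] at this
      rw [hp]
      exact this h1 h2
    · rw [hp, hp]; exact hf.2.2
  refine ⟨α, β, o₁, o₂, ε * c.s β * c.s α, f', hf', ?_⟩
  rw [mul_inv_eq_iff_eq_mul]
  refine conj_line c ε _ hf hf' (fun i => ?_) ?_
  · simp only [f']
    rw [← mul_assoc, Int.units_coe_mul_self]
    ring
  · rw [mul_assoc (ε * _), hu, mul_one, mul_assoc, hu, mul_one]

lemma mem_lineSet_of_hasType {a : AffineWeylC n} {ke : ℕ} (hsum : 2 + ke + 2 = n)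
    (ha : a.Involution) (ht : a.HasType 1 ke 2 0) : a ∈ lineSet n := by
  obtain ⟨-, h2, h3, h4⟩ := ht
  have hs : ∀ i, a.π i = i → a.s i = -1 := by
    intro i hi
    have h5 : {i : Fin n | a.π i = i ∧ a.s i = 1} = ∅ := by
      rwa [numPos, Set.ncard_eq_zero] at h4
    rcases Int.units_eq_one_or (a.s i) with h | h
    · exact absurd (show i ∈ {i : Fin n | a.π i = i ∧ a.s i = 1} from ⟨hi, h⟩) (by simp [h5])
    · exact h
  have hm : {i : Fin n | a.π i ≠ i}.ncard = 2 := by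
    have e1 : {i : Fin n | a.π i ≠ i}ᶜ =
        {i : Fin n | a.π i = i ∧ a.s i = -1 ∧ Even (a.v i)} ∪
        {i : Fin n | a.π i = i ∧ a.s i = -1 ∧ Odd (a.v i)} := by
      ext i
      simp only [Set.mem_compl_iff, Set.mem_ofPred_eq, not_not, Set.mem_union]
      constructor
      · intro hi
        rcases Int.even_or_odd (a.v i) with h | h
        · exact Or.inl ⟨hi, hs i hi, h⟩
        · exact Or.inr ⟨hi, hs i hi, h⟩
      · rintro (h | h) <;> exact h.1
    have e2 := Set.ncard_add_ncard_compl {i : Fin n | a.π i ≠ i}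
    rw [e1, Set.ncard_union_eq] at e2
    · rw [numNegEven] at h2
      rw [numNegOdd] at h3
      rw [h2, h3, Nat.card_eq_fintype_card, Fintype.card_fin] at e2
      omega
    · rw [Set.disjoint_left]
      rintro i ⟨-, -, h⟩ ⟨-, -, h'⟩
      exact (Int.not_even_iff_odd.mpr h') h
  obtain ⟨α, β, hαβ, hset⟩ := Set.ncard_eq_two.mp hm
  obtain ⟨o₁, o₂, ho, hset'⟩ := Set.ncard_eq_two.mp h3
  have hmv : ∀ i, a.π i ≠ i ↔ (i = α ∨ i = β) := fun i => by
    simpa using Set.ext_iff.mp hset i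
  have hod : ∀ i, (a.π i = i ∧ a.s i = -1 ∧ Odd (a.v i)) ↔ (i = o₁ ∨ i = o₂) := fun i => by
    simpa using Set.ext_iff.mp hset' i
  have hα := (hmv α).mpr (Or.inl rfl)
  have hβ := (hmv β).mpr (Or.inr rfl)
  have hπα : a.π α = β := by
    have := (hmv (a.π α)).mp fun e => hα (a.π.injective e)
    tauto
  have hπβ : a.π β = α := by
    have := (hmv (a.π β)).mp fun e => hβ (a.π.injective e)
    tauto
  have hπ : a.π = Equiv.swap α β := by
    ext1 i
    rw [Equiv.swap_apply_def]
    have := hmv i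
    grind
  have hss : a.s α = a.s β := by
    have : (a * a).s α = 1 := by rw [ha.2]; rfl
    rw [mul_s, hπα] at this
    rw [← Int.units_inv_eq_self (a.s β)]
    exact eq_inv_of_mul_eq_one_left this
  have hvv : (a.s α : ℤ) * a.v α + a.v β = 0 := by
    have : (a * a).v β = 0 := by rw [ha.2]; rfl
    rwa [mul_v, hπ, Equiv.swap_inv, Equiv.swap_apply_right] at this
  have h1 := (hod o₁).mpr (Or.inl rfl)
  have h2' := (hod o₂).mpr (Or.inr rfl)
  refine ⟨α, β, o₁, o₂, a.s α, fun i => if i = α then 2 * a.v α else if i = β then 0 else a.v i,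
    ⟨?_, fun i hiα hiβ => ?_, ?_⟩, ?_⟩
  · grind
  · simp only [hiα, hiβ, if_false]
    rw [← hod i, Int.odd_iff]
    have := (hmv i).not.mpr (by tauto)
    push Not at this
    simp [this, hs i this]
  · simp [hαβ.symm]
  · refine AffineWeylC.ext hπ (funext fun i => ?_) (funext fun i => ?_)
    · simp only [line]
      have := hmv i
      have := hs i
      grind
    · simp only [line]
      by_cases hiα : i = α
      · subst hiα; simp [hαβ.symm]
      by_cases hiβ : i = β
      · subst hiβ
        simp only [hαβ.symm, or_true, if_true, if_false, Equiv.swap_apply_right]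
        rw [show (0 : ℤ) - a.s α * (2 * a.v α) = 2 * (-(a.s α * a.v α)) by ring,
          Int.mul_ediv_cancel_left _ two_ne_zero]
        linarith
      · simp only [hiα, hiβ, or_self, if_false, Equiv.swap_apply_of_ne_of_ne hiα hiβ]
        simp only [Units.val_neg, Units.val_one]
        omega

lemma conjClass_eq_lineSet {a : AffineWeylC n} (ha : a ∈ lineSet n) :
    conjClass a = lineSet n := by
  ext b
  refine ⟨conj_mem_lineSet ha, ?_⟩
  rintro ⟨α, β, o₁, o₂, ε, f, hf, rfl⟩
  obtain ⟨γ, δ, u₁, u₂, σ, g, hg, rfl⟩ := ha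
  obtain ⟨f', hf', e⟩ := hf.exists_even ε
  obtain ⟨g', hg', e'⟩ := hg.exists_even σ
  rw [conjClass, Set.mem_ofPred_eq, e, e']
  exact isConj_line _ _ hg' hf'

lemma exists_notMem_list (l : List (Fin n)) (h : l.length < n) : ∃ x, x ∉ l := by
  by_contra! hc
  have h1 : (Finset.univ : Finset (Fin n)) ⊆ l.toFinset := fun x _ => by simpa using hc x
  have h2 := (Finset.card_le_card h1).trans l.toFinset_card_le
  rw [Finset.card_univ, Fintype.card_fin] at h2
  omega

lemma IsEvenFrame.slide {α β o₁ o₂ : Fin n} {f : Fin n → ℤ} (h : IsEvenFrame α β o₁ o₂ f)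
    (ε : ℤˣ) {z : ℤ} (hz : z % 2 = 0) : ∃ f', IsEvenFrame α β o₁ o₂ f' ∧
      line α β ε f = line α β ε f' ∧ f' α = z ∧ ∀ i, i ≠ α → i ≠ β → f' i = f i := by
  obtain ⟨f', h1, h2, h3, h4⟩ := exists_line_eq h.1.1 ε f z
  refine ⟨f', ⟨h.1, fun i => ?_⟩, h1, h2, h4⟩
  obtain ⟨hd, hp⟩ := h
  by_cases hα : i = α
  · subst hα; grind
  by_cases hβ : i = β
  · subst hβ; grind
  grind

lemma line_shift {α β : Fin n} {f f' : Fin n → ℤ} (h : ∀ i, i ≠ α → i ≠ β → f i = f' i)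
    (h' : f α - f β = f' α - f' β) : line α β 1 f = line α β 1 f' :=
  line_congr 1 h (by simpa using h')

lemma line_shift_neg {α β : Fin n} {f f' : Fin n → ℤ} (h : ∀ i, i ≠ α → i ≠ β → f i = f' i)
    (h' : f α + f β = f' α + f' β) : line α β (-1) f = line α β (-1) f' :=
  line_congr (-1) h (by simpa using h')

/-- Correcting the even coordinates in `T`, two at a time. -/
lemma near_sweep {α' β' o₁ o₂ : Fin n} {g : Fin n → ℤ} (σ : ℤˣ)
    (hg : IsEvenFrame α' β' o₁ o₂ g) (k : ℕ) : ∀ (T : Finset (Fin n)) (α β : Fin n) (ε : ℤˣ)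
    (f : Fin n → ℤ), T.card = 2 * k → IsEvenFrame α β o₁ o₂ f →
    (∀ i ∈ T, i ≠ α ∧ i ≠ β ∧ i ≠ α' ∧ i ≠ β' ∧ i ≠ o₁ ∧ i ≠ o₂) → (∀ i ∉ T, f i = g i) →
    (0 < k ∨ (α ≠ α' ∧ α ≠ β' ∧ β ≠ α' ∧ β ≠ β')) →
    Near (2 * k + 1) (line α β ε f) (line α' β' σ g) := by
  induction k with
  | zero =>
    intro T α β ε f hT hf _ hfg hd
    obtain rfl : T = ∅ := by simpa using hT
    obtain rfl : f = g := funext fun i => hfg i (by simp)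
    exact near_hop ε σ hf.isFrame hg.isFrame (by simpa using hd)
  | succ k ih =>
    intro T α β ε f hT hf hT' hfg _
    obtain ⟨c, T₁, hc, rfl, h1⟩ := Finset.card_eq_succ.mp (show T.card = (2 * k + 1) + 1 by omega)
    obtain ⟨d, T₂, hd, rfl, h2⟩ := Finset.card_eq_succ.mp h1
    simp only [Finset.mem_insert] at hc hT' hfg
    push Not at hc
    have hcT := hT' c (Or.inl rfl)
    have hdT := hT' d (Or.inr (Or.inl rfl))
    let f' : Fin n → ℤ := fun i => if i = c ∨ i = d then g i else f i
    have hf' : IsEvenFrame c d o₁ o₂ f' := by grind [IsEvenFrame]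
    have hfc : IsEvenFrame c d o₁ o₂ f := by grind [IsEvenFrame]
    have e1 := near_hop ε 1 hf.isFrame hfc.isFrame (by tauto)
    have e2 := near_flip (f' := f') 1 hfc.isFrame hf'.isFrame (by grind)
    have e3 := ih T₂ c d (-1) f' h2 hf' (by grind) (by grind) (Or.inr (by tauto))
    exact ((e1.trans e2).trans e3).mono (by omega)

/-- `near_sweep`, with the untouched coordinates given by a list. -/
lemma near_sweep_list {α β α' β' o₁ o₂ : Fin n} {f g : Fin n → ℤ} (ε σ : ℤˣ) (l : List (Fin n))
    (k : ℕ) (hf : IsEvenFrame α β o₁ o₂ f) (hg : IsEvenFrame α' β' o₁ o₂ g)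
    (hl : l.Nodup) (hk : n = l.length + 2 * k)
    (hm : α ∈ l ∧ β ∈ l ∧ α' ∈ l ∧ β' ∈ l ∧ o₁ ∈ l ∧ o₂ ∈ l) (hfg : ∀ i ∈ l, f i = g i)
    (hd : 0 < k ∨ (α ≠ α' ∧ α ≠ β' ∧ β ≠ α' ∧ β ≠ β')) :
    Near (2 * k + 1) (line α β ε f) (line α' β' σ g) := by
  refine near_sweep σ hg k (l.toFinset)ᶜ α β ε f ?_ hf ?_ (by simpa using hfg) hd
  · rw [Finset.card_compl, Fintype.card_fin, List.toFinset_card_of_nodup hl]; omega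
  · intro i hi
    rw [Finset.mem_compl, List.mem_toFinset] at hi
    refine ⟨?_, ?_, ?_, ?_, ?_, ?_⟩ <;> rintro rfl <;> tauto

/-- As `near_sweep_list`, with the values at the target transposition also corrected. -/
lemma near_sweep_flip {α β α' β' o₁ o₂ : Fin n} {f g : Fin n → ℤ} (ε σ : ℤˣ) (l : List (Fin n))
    (k : ℕ) (hf : IsEvenFrame α β o₁ o₂ f) (hg : IsEvenFrame α' β' o₁ o₂ g)
    (hl : l.Nodup) (hk : n = l.length + 2 * k)
    (hm : α ∈ l ∧ β ∈ l ∧ α' ∈ l ∧ β' ∈ l ∧ o₁ ∈ l ∧ o₂ ∈ l)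
    (hfg : ∀ i ∈ l, i ≠ α' → i ≠ β' → f i = g i)
    (hd : 0 < k ∨ (α ≠ α' ∧ α ≠ β' ∧ β ≠ α' ∧ β ≠ β')) :
    Near (2 * k + 2) (line α β ε f) (line α' β' σ g) := by
  let g' : Fin n → ℤ := fun i => if i = α' ∨ i = β' then f i else g i
  have hg' : IsEvenFrame α' β' o₁ o₂ g' := by grind [IsEvenFrame]
  have e1 := near_sweep_list (g := g') ε (-σ) l k hf hg' hl hk hm (by grind) hd
  have e2 := near_flip (f' := g) (-σ) hg'.isFrame hg.isFrame (by grind)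
  rw [neg_neg] at e2
  exact (e1.trans e2).mono (by omega)

/-- As `near_sweep_list`, with the values at the source transposition also corrected. -/
lemma near_flip_sweep {α β α' β' o₁ o₂ : Fin n} {f g : Fin n → ℤ} (ε σ : ℤˣ) (l : List (Fin n))
    (k : ℕ) (hf : IsEvenFrame α β o₁ o₂ f) (hg : IsEvenFrame α' β' o₁ o₂ g)
    (hl : l.Nodup) (hk : n = l.length + 2 * k)
    (hm : α ∈ l ∧ β ∈ l ∧ α' ∈ l ∧ β' ∈ l ∧ o₁ ∈ l ∧ o₂ ∈ l)
    (hfg : ∀ i ∈ l, i ≠ α → i ≠ β → f i = g i)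
    (hd : 0 < k ∨ (α ≠ α' ∧ α ≠ β' ∧ β ≠ α' ∧ β ≠ β')) :
    Near (2 * k + 2) (line α β ε f) (line α' β' σ g) := by
  let f' : Fin n → ℤ := fun i => if i = α ∨ i = β then g i else f i
  have hf' : IsEvenFrame α β o₁ o₂ f' := by grind [IsEvenFrame]
  have e1 := near_flip (f' := f') ε hf.isFrame hf'.isFrame (by grind)
  have e2 := near_sweep_list (f := f') (-ε) σ l k hf' hg hl hk hm (by grind) hd
  exact (e1.trans e2).mono (by omega)

/-- As `near_sweep_list`, with the values at both transpositions also corrected. -/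
lemma near_flip_sweep_flip {α β α' β' o₁ o₂ : Fin n} {f g : Fin n → ℤ} (ε σ : ℤˣ)
    (l : List (Fin n)) (k : ℕ) (hf : IsEvenFrame α β o₁ o₂ f) (hg : IsEvenFrame α' β' o₁ o₂ g)
    (hl : l.Nodup) (hk : n = l.length + 2 * k)
    (hm : α ∈ l ∧ β ∈ l ∧ α' ∈ l ∧ β' ∈ l ∧ o₁ ∈ l ∧ o₂ ∈ l)
    (hfg : ∀ i ∈ l, i ≠ α → i ≠ β → i ≠ α' → i ≠ β' → f i = g i)
    (hd : α ≠ α' ∧ α ≠ β' ∧ β ≠ α' ∧ β ≠ β') :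
    Near (2 * k + 3) (line α β ε f) (line α' β' σ g) := by
  let f' : Fin n → ℤ := fun i => if i = α ∨ i = β then g i else f i
  have hf' : IsEvenFrame α β o₁ o₂ f' := by grind [IsEvenFrame]
  have e1 := near_flip (f' := f') ε hf.isFrame hf'.isFrame (by grind)
  have e2 := near_sweep_flip (f := f') (-ε) σ l k hf' hg hl hk hm (by grind) (Or.inr hd)
  exact (e1.trans e2).mono (by omega)

/-! ### Frames with the same odd coordinates and the same values there -/

lemma near_of_odd_eq_of_disjoint {α β α' β' o₁ o₂ : Fin n} {f g : Fin n → ℤ} (ε σ : ℤˣ)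
    (hn : 7 ≤ n) (hf : IsEvenFrame α β o₁ o₂ f) (hg : IsEvenFrame α' β' o₁ o₂ g)
    (ho : f o₁ = g o₁ ∧ f o₂ = g o₂) (hd : α ≠ α' ∧ α ≠ β' ∧ β ≠ α' ∧ β ≠ β') :
    Near (n - 2) (line α β ε f) (line α' β' σ g) := by
  rcases Nat.even_or_odd' n with ⟨m, hm | hm⟩
  · refine (near_flip_sweep_flip ε σ [α, β, α', β', o₁, o₂] (m - 3) hf hg ?_ ?_ ?_ ?_ hd).mono
      (by omega)
    · grind [IsEvenFrame]
    · simp only [List.length_cons, List.length_nil]; omega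
    · simp
    · grind
  · obtain ⟨c, hc⟩ := exists_notMem_list [α, β, α', β', o₁, o₂] (by simp; omega)
    simp only [List.mem_cons, List.not_mem_nil, or_false] at hc
    push Not at hc
    let f₁ : Fin n → ℤ := fun i =>
      if i = α then g α - (g c - f c) else if i = β then g β else f i
    let f₂ : Fin n → ℤ := fun i =>
      if i = α then g α else if i = c then g c else f₁ i
    have h1 : IsEvenFrame α β o₁ o₂ f₁ := by grind [IsEvenFrame]
    have h2 : IsEvenFrame α' β' o₁ o₂ f₁ := by grind [IsEvenFrame]
    have h3 : IsEvenFrame c α o₁ o₂ f₁ := by grind [IsEvenFrame]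
    have h4 : IsEvenFrame c α o₁ o₂ f₂ := by grind [IsEvenFrame]
    have e1 := near_flip (f' := f₁) ε hf.isFrame h1.isFrame (by grind)
    have e2 := near_hop (-ε) 1 h1.isFrame h2.isFrame hd
    have e3 := near_hop 1 1 h2.isFrame h3.isFrame (by grind)
    rw [line_shift (f := f₁) (α := c) (f' := f₂) (by grind) (by grind)] at e3
    have e4 := near_sweep_flip 1 σ [α, β, α', β', o₁, o₂, c] (m - 3) h4 hg
      (by grind [IsEvenFrame]) (by simp only [List.length_cons, List.length_nil]; omega)
      (by simp) (by grind) (Or.inr (by grind))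
    exact (((e1.trans e2).trans e3).trans e4).mono (by omega)

lemma exists_pair_sum_mod_four {ι : Type*} (h : ι → ℤ) {c d e : ι} (hcd : c ≠ d) (hce : c ≠ e)
    (hde : d ≠ e) (hc : h c % 2 = 0) (hd : h d % 2 = 0) (he : h e % 2 = 0) :
    ∃ c' d' e', c' ≠ d' ∧ c' ≠ e' ∧ d' ≠ e' ∧ (h c' + h d') % 4 = 0 ∧
      (c' = c ∨ c' = d ∨ c' = e) ∧ (d' = c ∨ d' = d ∨ d' = e) ∧ (e' = c ∨ e' = d ∨ e' = e) := by
  by_cases h1 : (h c + h d) % 4 = 0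
  · exact ⟨c, d, e, by tauto⟩
  by_cases h2 : (h c + h e) % 4 = 0
  · exact ⟨c, e, d, by tauto⟩
  exact ⟨d, e, c, hde, hcd.symm, hce.symm, by omega, by tauto⟩

lemma near_of_odd_eq_of_eq {α β o₁ o₂ : Fin n} {f g : Fin n → ℤ} (ε σ : ℤˣ)
    (hn : 7 ≤ n) (hf : IsEvenFrame α β o₁ o₂ f) (hg : IsEvenFrame α β o₁ o₂ g)
    (ho : f o₁ = g o₁ ∧ f o₂ = g o₂) :
    Near (n - 2) (line α β ε f) (line α β σ g) := by
  rcases Nat.even_or_odd' n with ⟨m, hm | hm⟩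
  · refine (near_flip_sweep ε σ [α, β, o₁, o₂] (m - 2) hf hg ?_ ?_ ?_ ?_
      (Or.inl (by omega))).mono (by omega)
    · grind [IsEvenFrame]
    · simp only [List.length_cons, List.length_nil]; omega
    · simp
    · grind
  · obtain ⟨c₀, hc₀⟩ := exists_notMem_list [α, β, o₁, o₂] (by simp; omega)
    obtain ⟨d₀, hd₀⟩ := exists_notMem_list [α, β, o₁, o₂, c₀] (by simp; omega)
    obtain ⟨e₀, he₀⟩ := exists_notMem_list [α, β, o₁, o₂, c₀, d₀] (by simp; omega)
    simp only [List.mem_cons, List.not_mem_nil, or_false] at hc₀ hd₀ he₀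
    push Not at hc₀ hd₀ he₀
    obtain ⟨g, hg', hgl, hgβ, hgg⟩ : ∃ g', IsEvenFrame α β o₁ o₂ g' ∧
        line α β σ g = line α β σ g' ∧ g' β = f β ∧ ∀ i, i ≠ α → i ≠ β → g' i = g i := by
      obtain ⟨g', h1, h2, h3, h4⟩ := (show IsEvenFrame β α o₁ o₂ g by grind [IsEvenFrame]).slide σ
        (z := f β) (by grind [IsEvenFrame])
      exact ⟨g', by grind [IsEvenFrame], by rw [line_comm, h2, line_comm], h3,
        fun i hi hi' => h4 i hi' hi⟩
    rw [hgl]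
    obtain ⟨c, d, e, hcd, hce, hde, hmod, hc', hd', he'⟩ := exists_pair_sum_mod_four
      (fun i => g i - f i) (c := c₀) (d := d₀) (e := e₀) (by tauto) (by tauto) (by tauto)
      (by grind [IsEvenFrame]) (by grind [IsEvenFrame]) (by grind [IsEvenFrame])
    have hc : c ≠ α ∧ c ≠ β ∧ c ≠ o₁ ∧ c ≠ o₂ := by grind
    have hd : d ≠ α ∧ d ≠ β ∧ d ≠ o₁ ∧ d ≠ o₂ := by grind
    have he : e ≠ α ∧ e ≠ β ∧ e ≠ o₁ ∧ e ≠ o₂ := by grind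
    clear hc' hd' he' hc₀ hd₀ he₀
    obtain ⟨t, ht⟩ : ∃ t : ℤ, g c - f c + (g d - f d) = 4 * t := ⟨_,
      (Int.mul_ediv_cancel' (Int.dvd_of_emod_eq_zero hmod)).symm⟩
    let f₁ : Fin n → ℤ := fun i => if i = α ∨ i = c ∨ i = d ∨ i = e then f i else g i
    let f₂ : Fin n → ℤ := fun i => if i = c ∨ i = d then f i + 2 * t else f₁ i
    let f₃ : Fin n → ℤ := fun i => if i = c ∨ i = d then f i + 2 * t else g i
    have h1 : IsEvenFrame c d o₁ o₂ f₁ := by grind [IsEvenFrame]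
    have h2 : IsEvenFrame c d o₁ o₂ f₂ := by grind [IsEvenFrame]
    have h3 : IsEvenFrame e α o₁ o₂ f₂ := by grind [IsEvenFrame]
    have h4 : IsEvenFrame e α o₁ o₂ f₃ := by grind [IsEvenFrame]
    have h5 : IsEvenFrame c d o₁ o₂ f₃ := by grind [IsEvenFrame]
    have h6 : IsEvenFrame c d o₁ o₂ g := by grind [IsEvenFrame]
    have e1 := near_sweep_list ε 1 [α, β, o₁, o₂, c, d, e] (m - 3) hf h1
      (by grind [IsEvenFrame]) (by simp only [List.length_cons, List.length_nil]; omega)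
      (by simp) (by grind) (Or.inr (by grind))
    rw [line_shift (f := f₁) (f' := f₂) (by grind) (by grind)] at e1
    have e2 := near_hop 1 1 h2.isFrame h3.isFrame (by grind)
    have e3 := near_flip 1 h3.isFrame h4.isFrame (by grind)
    have e4 := near_hop (-1) (-1) h4.isFrame h5.isFrame (by grind)
    rw [line_shift_neg (f := f₃) (α := c) (f' := g) (by grind) (by grind)] at e4
    have e5 := near_hop (-1) σ h6.isFrame hg'.isFrame (by grind)
    exact ((((e1.trans e2).trans e3).trans e4).trans e5).mono (by omega)

lemma near_of_odd_eq_of_overlap {p q w o₁ o₂ : Fin n} {f g : Fin n → ℤ} (ε σ : ℤˣ)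
    (hn : 7 ≤ n) (hf : IsEvenFrame p q o₁ o₂ f) (hg : IsEvenFrame p w o₁ o₂ g) (hw : w ≠ q)
    (ho : f o₁ = g o₁ ∧ f o₂ = g o₂) :
    Near (n - 2) (line p q ε f) (line p w σ g) := by
  have hgw : IsEvenFrame w p o₁ o₂ g := by grind [IsEvenFrame]
  rw [line_comm p w]
  rcases Nat.even_or_odd' n with ⟨m, hm | hm⟩
  · obtain ⟨c, hc⟩ := exists_notMem_list [p, q, w, o₁, o₂] (by simp; omega)
    simp only [List.mem_cons, List.not_mem_nil, or_false] at hc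
    push Not at hc
    obtain ⟨g', hg', e0, hz, hgg⟩ := hgw.slide σ (z := f w + (g c - f c)) (by grind [IsEvenFrame])
    let f₁ : Fin n → ℤ := fun i => if i = p ∨ i = q then g' i else f i
    let f₂ : Fin n → ℤ := fun i => if i = c ∨ i = w then g' i else f₁ i
    have h1 : IsEvenFrame p q o₁ o₂ f₁ := by grind [IsEvenFrame]
    have h2 : IsEvenFrame c w o₁ o₂ f₁ := by grind [IsEvenFrame]
    have h3 : IsEvenFrame c w o₁ o₂ f₂ := by grind [IsEvenFrame]
    have e1 := near_flip ε hf.isFrame h1.isFrame (by grind)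
    have e2 := near_hop (-ε) 1 h1.isFrame h2.isFrame (by grind [IsEvenFrame])
    rw [line_shift (f := f₁) (α := c) (f' := f₂) (by grind) (by grind [IsEvenFrame])] at e2
    have e3 := near_sweep_list 1 σ [p, q, w, o₁, o₂, c] (m - 3) h3 hg'
      (by grind [IsEvenFrame]) (by simp only [List.length_cons, List.length_nil]; omega)
      (by simp) (by grind [IsEvenFrame]) (Or.inl (by omega))
    rw [e0]
    exact ((e1.trans e2).trans e3).mono (by omega)
  · obtain ⟨g', hg', e0, hz, hgg⟩ := hgw.slide σ (z := f w) (by grind [IsEvenFrame])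
    rw [e0]
    refine (near_flip_sweep ε σ [p, q, w, o₁, o₂] (m - 2) hf hg' ?_ ?_ ?_ ?_
      (Or.inl (by omega))).mono (by omega)
    · grind [IsEvenFrame]
    · simp only [List.length_cons, List.length_nil]; omega
    · simp
    · grind [IsEvenFrame]

lemma near_of_odd_eq {α β α' β' o₁ o₂ : Fin n} {f g : Fin n → ℤ} (ε σ : ℤˣ)
    (hn : 7 ≤ n) (hf : IsEvenFrame α β o₁ o₂ f) (hg : IsEvenFrame α' β' o₁ o₂ g)
    (ho : f o₁ = g o₁ ∧ f o₂ = g o₂) :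
    Near (n - 2) (line α β ε f) (line α' β' σ g) := by
  have hf' : IsEvenFrame β α o₁ o₂ f := by grind [IsEvenFrame]
  have hg' : IsEvenFrame β' α' o₁ o₂ g := by grind [IsEvenFrame]
  have hd := hf.1.1
  have hd' := hg.1.1
  by_cases h1 : α = α'
  · subst h1
    by_cases h2 : β = β'
    · subst h2; exact near_of_odd_eq_of_eq ε σ hn hf hg ho
    · exact near_of_odd_eq_of_overlap ε σ hn hf hg (Ne.symm h2) ho
  by_cases h2 : α = β'
  · subst h2
    rw [line_comm α']
    by_cases h3 : β = α'
    · subst h3; exact near_of_odd_eq_of_eq ε σ hn hf hg' ho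
    · exact near_of_odd_eq_of_overlap ε σ hn hf hg' (Ne.symm h3) ho
  by_cases h3 : β = α'
  · subst h3
    rw [line_comm α]
    exact near_of_odd_eq_of_overlap ε σ hn hf' hg (Ne.symm h2) ho
  by_cases h4 : β = β'
  · subst h4
    rw [line_comm α, line_comm α']
    exact near_of_odd_eq_of_overlap ε σ hn hf' hg' (Ne.symm h1) ho
  exact near_of_odd_eq_of_disjoint ε σ hn hf hg ho ⟨h1, h2, h3, h4⟩

/-! ### Changing the odd coordinates -/

lemma near_of_odd_disjoint {α β α' β' o₁ o₂ u₁ u₂ : Fin n} {f g : Fin n → ℤ} (ε σ : ℤˣ)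
    (hn : 7 ≤ n) (hf : IsEvenFrame α β o₁ o₂ f) (hg : IsEvenFrame α' β' u₁ u₂ g)
    (h₁ : u₁ ≠ α ∧ u₁ ≠ β ∧ u₁ ≠ o₁ ∧ u₁ ≠ o₂) (h₂ : u₂ ≠ α ∧ u₂ ≠ β ∧ u₂ ≠ o₁ ∧ u₂ ≠ o₂) :
    Near (n + 1) (line α β ε f) (line α' β' σ g) := by
  let f₁ : Fin n → ℤ := fun i => if i = u₁ ∨ i = u₂ then g i else f i
  let f₂ : Fin n → ℤ := fun i => if i = o₁ ∨ i = o₂ then f i + 1 else f₁ i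
  have hf₀ : IsFrame u₁ u₂ o₁ o₂ f := by grind [IsEvenFrame, IsFrame]
  have hf₁ : IsFrame u₁ u₂ o₁ o₂ f₁ := by grind [IsEvenFrame, IsFrame]
  have hf₁' : IsFrame o₁ o₂ u₁ u₂ f₁ := by grind [IsEvenFrame, IsFrame]
  have hf₂ : IsEvenFrame o₁ o₂ u₁ u₂ f₂ := by grind [IsEvenFrame]
  have e1 := near_hop ε 1 hf.isFrame hf₀ (by grind)
  have e2 := near_flip (f' := f₁) 1 hf₀ hf₁ (by grind)
  have e3 := near_hop (-1) 1 hf₁ hf₁' (by grind)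
  rw [line_shift (α := o₁) (f := f₁) (f' := f₂) (by grind) (by grind)] at e3
  have e4 := near_of_odd_eq 1 σ hn hf₂ hg (by grind)
  exact (((e1.trans e2).trans e3).trans e4).mono (by omega)

lemma near_of_odd_eq_source {α β α' β' o₁ o₂ : Fin n} {f g : Fin n → ℤ} (ε σ : ℤˣ)
    (hn : 7 ≤ n) (hf : IsEvenFrame α β o₁ o₂ f) (hg : IsEvenFrame α' β' α β g) :
    Near (n + 1) (line α β ε f) (line α' β' σ g) := by
  let f₁ : Fin n → ℤ := fun i => if i = α ∨ i = β then g i else f i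
  let f₂ : Fin n → ℤ := fun i => if i = o₁ ∨ i = o₂ then f i + 1 else f₁ i
  have hf₁ : IsFrame α β o₁ o₂ f₁ := by grind [IsEvenFrame, IsFrame]
  have hf₁' : IsFrame o₁ o₂ α β f₁ := by grind [IsEvenFrame, IsFrame]
  have hf₂ : IsEvenFrame o₁ o₂ α β f₂ := by grind [IsEvenFrame]
  have e1 := near_flip (f' := f₁) ε hf.isFrame hf₁ (by grind)
  have e2 := near_hop (-ε) 1 hf₁ hf₁' (by grind [IsFrame])
  rw [line_shift (α := o₁) (f := f₁) (f' := f₂) (by grind) (by grind [IsFrame])] at e2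
  have e3 := near_of_odd_eq 1 σ hn hf₂ hg (by grind [IsFrame])
  exact ((e1.trans e2).trans e3).mono (by omega)

/-- Sliding the base point so that the coordinates of the transposition become odd. -/
lemma IsEvenFrame.slide_odd {α β o₁ o₂ : Fin n} {f : Fin n → ℤ} (h : IsEvenFrame α β o₁ o₂ f)
    (ε : ℤˣ) : ∃ f', IsFrame α β o₁ o₂ f' ∧ IsFrame o₁ o₂ α β f' ∧
      line α β ε f = line α β ε f' ∧ ∀ i, i ≠ α → i ≠ β → f' i = f i := by
  obtain ⟨f', h1, h2, h3, h4⟩ := exists_line_eq h.1.1 ε f (f α + 1)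
  have hα := h.2 α
  have hβ := h.2 β
  have hd := h.1
  have hαo : f' α % 2 = 1 := by grind
  have hβo : f' β % 2 = 1 := by grind
  exact ⟨f', by grind [IsEvenFrame, IsFrame], by grind [IsEvenFrame, IsFrame], h1, h4⟩

lemma near_of_same_odd {α β α' β' o₁ o₂ : Fin n} {f g : Fin n → ℤ} (ε σ : ℤˣ)
    (hn : 7 ≤ n) (hf : IsEvenFrame α β o₁ o₂ f) (hg : IsEvenFrame α' β' o₁ o₂ g) :
    Near (n + 1) (line α β ε f) (line α' β' σ g) := by
  obtain ⟨f₀, h0, h0', hl, hoff⟩ := hf.slide_odd ε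
  rw [hl]
  let f₁ : Fin n → ℤ := fun i => if i = o₁ ∨ i = o₂ then g i else f₀ i
  let f₂ : Fin n → ℤ := fun i => if i = α ∨ i = β then f₀ i + 1 else f₁ i
  have hf₁ : IsFrame o₁ o₂ α β f₁ := by grind [IsEvenFrame, IsFrame]
  have hf₁' : IsFrame α β o₁ o₂ f₁ := by grind [IsEvenFrame, IsFrame]
  have hf₂ : IsEvenFrame α β o₁ o₂ f₂ := by grind [IsEvenFrame, IsFrame]
  have e1 := near_hop ε 1 h0 h0' (by grind [IsFrame])
  have e2 := near_flip (f' := f₁) 1 h0' hf₁ (by grind)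
  have e3 := near_hop (-1) 1 hf₁ hf₁' (by grind [IsFrame])
  rw [line_shift (α := α) (f := f₁) (f' := f₂) (by grind) (by grind [IsFrame])] at e3
  have e4 := near_of_odd_eq 1 σ hn hf₂ hg (by grind [IsFrame])
  exact (((e1.trans e2).trans e3).trans e4).mono (by omega)

lemma near_of_odd_meets_source {α β α' β' o₁ o₂ e : Fin n} {f g : Fin n → ℤ} (ε σ : ℤˣ)
    (hn : 7 ≤ n) (hf : IsEvenFrame α β o₁ o₂ f) (hg : IsEvenFrame α' β' α e g)
    (he : e ≠ β ∧ e ≠ o₁ ∧ e ≠ o₂) :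
    Near (n + 1) (line α β ε f) (line α' β' σ g) := by
  obtain ⟨r, hr⟩ := exists_notMem_list [α, β, o₁, o₂, e] (by simp; omega)
  obtain ⟨s, hs⟩ := exists_notMem_list [α, β, o₁, o₂, e, r] (by simp; omega)
  simp only [List.mem_cons, List.not_mem_nil, or_false] at hr hs
  push Not at hr hs
  obtain ⟨f₀, h0, hl, hα, hoff⟩ := hf.slide ε (z := g α - (g e - f e)) (by grind [IsEvenFrame])
  rw [hl]
  let f₁ : Fin n → ℤ := fun i => if i = α ∨ i = e then g i else f₀ i
  let f₂ : Fin n → ℤ := fun i => if i = o₁ ∨ i = o₂ then f₁ i + 1 else f₁ i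
  have hrs : IsEvenFrame r s o₁ o₂ f₀ := by grind [IsEvenFrame]
  have hαe : IsEvenFrame α e o₁ o₂ f₀ := by grind [IsEvenFrame]
  have hf₁ : IsFrame α e o₁ o₂ f₁ := by grind [IsEvenFrame, IsFrame]
  have hf₁' : IsFrame o₁ o₂ α e f₁ := by grind [IsEvenFrame, IsFrame]
  have hf₂ : IsEvenFrame o₁ o₂ α e f₂ := by grind [IsEvenFrame]
  have e1 := near_hop ε 1 h0.isFrame hrs.isFrame (by grind)
  have e2 := near_hop 1 1 hrs.isFrame hαe.isFrame (by grind)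
  rw [line_shift (α := α) (f := f₀) (f' := f₁) (by grind) (by grind)] at e2
  have e3 := near_hop 1 1 hf₁ hf₁' (by grind [IsFrame])
  rw [line_shift (α := o₁) (f := f₁) (f' := f₂) (by grind) (by grind [IsFrame])] at e3
  have e4 := near_of_odd_eq 1 σ hn hf₂ hg (by grind [IsFrame])
  exact (((e1.trans e2).trans e3).trans e4).mono (by omega)

/-! ### Exchanging one odd coordinate for an even one -/

/-- The common tail of the paths exchanging the odd coordinate `b` for `c`. -/
lemma exchange_tail {p q a b c s₁ s₂ : Fin n} {f g : Fin n → ℤ} (τ : ℤˣ)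
    (hf : IsFrame a b p q f) (hfa : f a % 2 = 0)
    (hg : g a % 2 = 1 ∧ g c % 2 = 1 ∧ g s₁ % 2 = 0)
    (hc : c ≠ p ∧ c ≠ q ∧ c ≠ a ∧ c ≠ b)
    (h₁ : s₁ ≠ p ∧ s₁ ≠ q ∧ s₁ ≠ a ∧ s₁ ≠ b ∧ s₁ ≠ c)
    (h₂ : s₂ ≠ p ∧ s₂ ≠ q ∧ s₂ ≠ a ∧ s₂ ≠ b ∧ s₂ ≠ c ∧ s₂ ≠ s₁)
    (hac : f a - f c = g a - g c) :
    ∃ f', IsEvenFrame p q a c f' ∧ Near 3 (line a b τ f) (line p q 1 f') ∧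
      f' a = g a ∧ f' c = g c ∧ f' s₁ = g s₁ ∧ f' b = f b := by
  let f₁ : Fin n → ℤ := fun i =>
    if i = s₁ then g s₁ else if i = s₂ then f s₂ + g s₁ - f s₁ else f i
  let f₂ : Fin n → ℤ := fun i => if i = a ∨ i = c then g i else f₁ i
  let f₃ : Fin n → ℤ := fun i => if i = p ∨ i = q then f₂ i + 1 else f₂ i
  have hs : IsFrame s₁ s₂ p q f := by grind [IsFrame]
  have hs' : IsFrame s₁ s₂ p q f₁ := by grind [IsFrame]
  have hac₁ : IsFrame a c p q f₁ := by grind [IsFrame]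
  have hac₂ : IsFrame a c p q f₂ := by grind [IsFrame]
  have hpq : IsFrame p q a c f₂ := by grind [IsFrame]
  have hpqo : f₂ p % 2 = 1 ∧ f₂ q % 2 = 1 := by grind [IsFrame]
  have hpq' : IsEvenFrame p q a c f₃ := by
    refine ⟨hpq.1, fun i => ?_⟩
    have hi := hpq.2.1 i
    have hd := hpq.1
    grind
  have e1 := near_hop τ 1 hf hs (by grind)
  rw [line_shift (α := s₁) (f := f) (f' := f₁) (by grind) (by grind)] at e1
  have e2 := near_hop 1 1 hs' hac₁ (by grind)
  rw [line_shift (α := a) (f := f₁) (f' := f₂) (by grind) (by grind)] at e2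
  have e3 := near_hop 1 1 hac₂ hpq (by grind [IsFrame])
  rw [line_shift (α := p) (f := f₂) (f' := f₃) (by grind) (by simp [f₃])] at e3
  exact ⟨f₃, hpq', ((e1.trans e2).trans e3).mono (by omega), by grind [IsFrame], by grind,
    by grind, by grind [IsFrame]⟩

lemma exchange {p q a b c s₁ s₂ : Fin n} {f g : Fin n → ℤ} (ε : ℤˣ)
    (hf : IsEvenFrame p q a b f) (hg : g a % 2 = 1 ∧ g c % 2 = 1 ∧ g s₁ % 2 = 0)
    (hc : c ≠ p ∧ c ≠ q ∧ c ≠ a ∧ c ≠ b)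
    (h₁ : s₁ ≠ p ∧ s₁ ≠ q ∧ s₁ ≠ a ∧ s₁ ≠ b ∧ s₁ ≠ c)
    (h₂ : s₂ ≠ p ∧ s₂ ≠ q ∧ s₂ ≠ a ∧ s₂ ≠ b ∧ s₂ ≠ c ∧ s₂ ≠ s₁) :
    ∃ f', IsEvenFrame p q a c f' ∧ Near 4 (line p q ε f) (line p q 1 f') ∧
      f' a = g a ∧ f' c = g c ∧ f' s₁ = g s₁ := by
  obtain ⟨f₀, h0, h0', hl, hoff⟩ := hf.slide_odd ε
  rw [hl]
  let f₁ : Fin n → ℤ := fun i => if i = a ∨ i = b then f i + (f c + g a - g c - f a) else f₀ i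
  have hf₁ : IsFrame a b p q f₁ := by grind [IsEvenFrame, IsFrame]
  have e1 := near_hop ε 1 h0 h0' (by grind [IsFrame])
  rw [line_shift (α := a) (f := f₀) (f' := f₁) (by grind) (by grind [IsFrame])] at e1
  obtain ⟨f', hf', e2, ha', hc', hs', -⟩ := exchange_tail (g := g) 1 hf₁ (by grind [IsEvenFrame])
    hg hc h₁ h₂ (by grind [IsFrame])
  exact ⟨f', hf', (e1.trans e2).mono (by omega), ha', hc', hs'⟩

/-- As `exchange`, with one more step, also prescribing the value at `b`. -/
lemma exchange_flip {p q a b c s₁ s₂ : Fin n} {f g : Fin n → ℤ} (ε : ℤˣ)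
    (hf : IsEvenFrame p q a b f)
    (hg : g a % 2 = 1 ∧ g c % 2 = 1 ∧ g s₁ % 2 = 0) (hb : g b % 2 = 0)
    (hc : c ≠ p ∧ c ≠ q ∧ c ≠ a ∧ c ≠ b)
    (h₁ : s₁ ≠ p ∧ s₁ ≠ q ∧ s₁ ≠ a ∧ s₁ ≠ b ∧ s₁ ≠ c)
    (h₂ : s₂ ≠ p ∧ s₂ ≠ q ∧ s₂ ≠ a ∧ s₂ ≠ b ∧ s₂ ≠ c ∧ s₂ ≠ s₁) :
    ∃ f', IsEvenFrame p q a c f' ∧ Near 5 (line p q ε f) (line p q 1 f') ∧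
      f' a = g a ∧ f' c = g c ∧ f' s₁ = g s₁ ∧ f' b = g b := by
  obtain ⟨f₀, h0, h0', hl, hoff⟩ := hf.slide_odd ε
  rw [hl]
  let f₁ : Fin n → ℤ := fun i => if i = a then f c + g a - g c else if i = b then g b else f₀ i
  have hf₁ : IsFrame a b p q f₁ := by grind [IsEvenFrame, IsFrame]
  have e1 := near_hop ε 1 h0 h0' (by grind [IsFrame])
  have e2 := near_flip (f' := f₁) 1 h0' hf₁ (by grind)
  obtain ⟨f', hf', e3, ha', hc', hs', hb'⟩ := exchange_tail (g := g) (-1) hf₁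
    (by grind [IsEvenFrame]) hg hc h₁ h₂ (by grind [IsFrame])
  exact ⟨f', hf', ((e1.trans e2).trans e3).mono (by omega), ha', hc', hs', by grind [IsFrame]⟩

lemma near_of_exchange_of_disjoint {p q p' q' a b c : Fin n} {f g : Fin n → ℤ} (ε σ : ℤˣ)
    (hn : 7 ≤ n) (hf : IsEvenFrame p q a b f) (hg : IsEvenFrame p' q' a c g)
    (hc : c ≠ p ∧ c ≠ q ∧ c ≠ a ∧ c ≠ b) (hd : p ≠ p' ∧ p ≠ q' ∧ q ≠ p' ∧ q ≠ q')
    (hb : b ≠ q') :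
    Near (n + 1) (line p q ε f) (line p' q' σ g) := by
  obtain ⟨s₁, h₁⟩ := exists_notMem_list [p, q, a, b, c, q'] (by simp; omega)
  obtain ⟨s₂, h₂⟩ := exists_notMem_list [p, q, a, b, c, s₁] (by simp; omega)
  simp only [List.mem_cons, List.not_mem_nil, or_false] at h₁ h₂
  push Not at h₁ h₂
  have hg₁ : g a % 2 = 1 ∧ g c % 2 = 1 ∧ g s₁ % 2 = 0 := by grind [IsEvenFrame]
  have h₁' : s₁ ≠ p ∧ s₁ ≠ q ∧ s₁ ≠ a ∧ s₁ ≠ b ∧ s₁ ≠ c := by tauto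
  have hpq := hf.1
  have hpq' := hg.1
  rcases Nat.even_or_odd' n with ⟨m, hm | hm⟩
  · obtain ⟨f', hf', e1, ha', hc', -⟩ := exchange (g := g) ε hf hg₁ hc h₁' h₂
    have e2 := near_flip_sweep_flip 1 σ [p, q, p', q', a, c] (m - 3) hf' hg
      (by grind) (by simp only [List.length_cons, List.length_nil]; omega) (by simp)
      (by grind) hd
    exact (e1.trans e2).mono (by omega)
  · by_cases hbp : b = p'
    · obtain ⟨f', hf', e1, ha', hc', hs'⟩ := exchange (g := g) ε hf hg₁ hc h₁' h₂
      have e2 := near_flip_sweep_flip 1 σ [p, q, p', q', a, c, s₁] (m - 3) hf' hg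
        (by grind) (by simp only [List.length_cons, List.length_nil]; omega) (by simp)
        (by grind) hd
      exact (e1.trans e2).mono (by omega)
    · obtain ⟨f', hf', e1, ha', hc', -, hb'⟩ := exchange_flip (g := g) ε hf hg₁
        (by grind [IsEvenFrame]) hc h₁' h₂
      have e2 := near_flip_sweep_flip 1 σ [p, q, p', q', a, c, b] (m - 3) hf' hg
        (by grind) (by simp only [List.length_cons, List.length_nil]; omega) (by simp)
        (by grind) hd
      exact (e1.trans e2).mono (by omega)

lemma near_of_exchange_of_eq {p q a b c : Fin n} {f g : Fin n → ℤ} (ε σ : ℤˣ)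
    (hn : 7 ≤ n) (hf : IsEvenFrame p q a b f) (hg : IsEvenFrame p q a c g)
    (hc : c ≠ p ∧ c ≠ q ∧ c ≠ a ∧ c ≠ b) :
    Near (n + 1) (line p q ε f) (line p q σ g) := by
  obtain ⟨s₁, h₁⟩ := exists_notMem_list [p, q, a, b, c] (by simp; omega)
  obtain ⟨s₂, h₂⟩ := exists_notMem_list [p, q, a, b, c, s₁] (by simp; omega)
  simp only [List.mem_cons, List.not_mem_nil, or_false] at h₁ h₂
  push Not at h₁ h₂
  have hg₁ : g a % 2 = 1 ∧ g c % 2 = 1 ∧ g s₁ % 2 = 0 := by grind [IsEvenFrame]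
  have hpq := hf.1
  rcases Nat.even_or_odd' n with ⟨m, hm | hm⟩
  · obtain ⟨f', hf', e1, ha', hc', hs', hb'⟩ := exchange_flip (g := g) ε hf hg₁
      (by grind [IsEvenFrame]) hc h₁ h₂
    have e2 := near_flip_sweep 1 σ [p, q, a, c, b, s₁] (m - 3) hf' hg
      (by grind) (by simp only [List.length_cons, List.length_nil]; omega) (by simp)
      (by grind) (Or.inl (by omega))
    exact (e1.trans e2).mono (by omega)
  · obtain ⟨f', hf', e1, ha', hc', hs'⟩ := exchange (g := g) ε hf hg₁ hc h₁ h₂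
    have e2 := near_flip_sweep 1 σ [p, q, a, c, s₁] (m - 2) hf' hg
      (by grind) (by simp only [List.length_cons, List.length_nil]; omega) (by simp)
      (by grind) (Or.inl (by omega))
    exact (e1.trans e2).mono (by omega)

lemma near_of_exchange_of_overlap {p q w a b c : Fin n} {f g : Fin n → ℤ} (ε σ : ℤˣ)
    (hn : 7 ≤ n) (hf : IsEvenFrame p q a b f) (hg : IsEvenFrame p w a c g) (hw : w ≠ q)
    (hc : c ≠ p ∧ c ≠ q ∧ c ≠ a ∧ c ≠ b) :
    Near (n + 1) (line p q ε f) (line p w σ g) := by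
  have hgw : IsEvenFrame w p a c g := by grind [IsEvenFrame]
  rw [line_comm p w]
  obtain ⟨s₁, h₁⟩ := exists_notMem_list [p, q, a, b, c, w] (by simp; omega)
  obtain ⟨s₂, h₂⟩ := exists_notMem_list [p, q, a, b, c, s₁] (by simp; omega)
  simp only [List.mem_cons, List.not_mem_nil, or_false] at h₁ h₂
  push Not at h₁ h₂
  have hg₁ : g a % 2 = 1 ∧ g c % 2 = 1 ∧ g s₁ % 2 = 0 := by grind [IsEvenFrame]
  have hpq := hf.1
  have hpw := hg.1
  obtain ⟨f', hf', e1, ha', hc', hs'⟩ := exchange (g := g) ε hf hg₁ hc (by tauto) h₂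
  obtain ⟨g', hg', hl, hgw', hoff⟩ := hgw.slide σ (z := f' w) (by grind [IsEvenFrame])
  rw [hl]
  rcases Nat.even_or_odd' n with ⟨m, hm | hm⟩
  · have e2 := near_flip_sweep 1 σ [p, q, w, a, c, s₁] (m - 3) hf' hg'
      (by grind) (by simp only [List.length_cons, List.length_nil]; omega) (by simp)
      (by grind) (Or.inl (by omega))
    exact (e1.trans e2).mono (by omega)
  · have e2 := near_flip_sweep 1 σ [p, q, w, a, c] (m - 2) hf' hg'
      (by grind) (by simp only [List.length_cons, List.length_nil]; omega) (by simp)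
      (by grind) (Or.inl (by omega))
    exact (e1.trans e2).mono (by omega)

lemma near_of_exchange {α β α' β' a b c : Fin n} {f g : Fin n → ℤ} (ε σ : ℤˣ)
    (hn : 7 ≤ n) (hf : IsEvenFrame α β a b f) (hg : IsEvenFrame α' β' a c g)
    (hc : c ≠ α ∧ c ≠ β ∧ c ≠ b) :
    Near (n + 1) (line α β ε f) (line α' β' σ g) := by
  have hf' : IsEvenFrame β α a b f := by grind [IsEvenFrame]
  have hg' : IsEvenFrame β' α' a c g := by grind [IsEvenFrame]
  have hd := hf.1
  have hd' := hg.1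
  by_cases h1 : α = α'
  · subst h1
    by_cases h2 : β = β'
    · subst h2; exact near_of_exchange_of_eq ε σ hn hf hg (by tauto)
    · exact near_of_exchange_of_overlap ε σ hn hf hg (Ne.symm h2) (by tauto)
  by_cases h2 : α = β'
  · subst h2
    rw [line_comm α']
    by_cases h3 : β = α'
    · subst h3; exact near_of_exchange_of_eq ε σ hn hf hg' (by tauto)
    · exact near_of_exchange_of_overlap ε σ hn hf hg' (Ne.symm h3) (by tauto)
  by_cases h3 : β = α'
  · subst h3
    rw [line_comm α]
    exact near_of_exchange_of_overlap ε σ hn hf' hg (Ne.symm h2) (by tauto)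
  by_cases h4 : β = β'
  · subst h4
    rw [line_comm α, line_comm α']
    exact near_of_exchange_of_overlap ε σ hn hf' hg' (Ne.symm h1) (by tauto)
  by_cases h5 : b = β'
  · rw [line_comm α']
    exact near_of_exchange_of_disjoint ε σ hn hf hg' (by tauto) ⟨h2, h1, h4, h3⟩
      (by rintro rfl; tauto)
  · exact near_of_exchange_of_disjoint ε σ hn hf hg (by tauto) ⟨h1, h2, h3, h4⟩ h5

/-! ### Exchanging an odd coordinate for one moved by the transposition -/

lemma cross_head {a b c q r s : Fin n} {f g : Fin n → ℤ} (ε : ℤˣ) {z : ℤ}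
    (hf : IsEvenFrame c q a b f) (hg : g a % 2 = 1 ∧ g c % 2 = 1) (hgb : g b % 2 = 0)
    (hgr : g r % 2 = 0 ∧ g s % 2 = 0) (hz : z % 2 = 0)
    (hr : r ≠ a ∧ r ≠ b ∧ r ≠ c ∧ r ≠ q) (hs : s ≠ a ∧ s ≠ b ∧ s ≠ c ∧ s ≠ q ∧ s ≠ r) :
    ∃ f', IsFrame a b r s f' ∧ Near 4 (line c q ε f) (line a b (-1) f') ∧
      f' a - f' c = g a - g c ∧ f' a % 2 = 0 ∧ f' b = g b ∧ f' q = z ∧ f' r = g r + 1 ∧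
      f' s = g s + 1 ∧ ∀ i, i ≠ a → i ≠ b → i ≠ c → i ≠ q → i ≠ r → i ≠ s → f' i = f i := by
  have hf' : IsEvenFrame q c a b f := by grind [IsEvenFrame]
  obtain ⟨f₀, h0, hl, hq, hoff⟩ := hf'.slide ε hz
  rw [line_comm c q, hl]
  let f₁ : Fin n → ℤ := fun i => if i = r ∨ i = s then g i + 1 else f₀ i
  let f₂ : Fin n → ℤ := fun i =>
    if i = a then g a - g c + f₀ c else if i = b then g b else f₁ i
  have hd := h0.1
  have hrs₀ : IsEvenFrame r s a b f₀ := by grind [IsEvenFrame]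
  have hrs₁ : IsFrame r s a b f₁ := by grind [IsEvenFrame, IsFrame]
  have hab₁ : IsFrame a b r s f₁ := by grind [IsEvenFrame, IsFrame]
  have hab₂ : IsFrame a b r s f₂ := by grind [IsEvenFrame, IsFrame]
  have hc : f₀ c % 2 = 0 := by grind [IsEvenFrame]
  have e1 := near_hop ε 1 h0.isFrame hrs₀.isFrame (by grind)
  have e2 := near_flip (f' := f₁) 1 hrs₀.isFrame hrs₁ (by grind)
  have e3 := near_hop (-1) 1 hrs₁ hab₁ (by grind)
  have e4 := near_flip (f' := f₂) 1 hab₁ hab₂ (by grind)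
  exact ⟨f₂, hab₂, (((e1.trans e2).trans e3).trans e4).mono (by omega), by grind, by grind,
    by grind, by grind, by grind, by grind, by grind⟩

lemma cross_tail {a c r s u v : Fin n} {f g : Fin n → ℤ} (τ : ℤˣ) (hf : IsFrame u v r s f)
    (hfa : f a % 2 = 0) (hg : g a % 2 = 1 ∧ g c % 2 = 1) (hac : f a - f c = g a - g c)
    (hrs : f r = g r + 1 ∧ f s = g s + 1) (hd : a ≠ c ∧ a ≠ r ∧ a ≠ s ∧ c ≠ r ∧ c ≠ s)
    (huv : u ≠ a ∧ u ≠ c ∧ v ≠ a ∧ v ≠ c) (hfu : f u % 2 = 0) :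
    ∃ f', IsEvenFrame r s a c f' ∧ Near 2 (line u v τ f) (line r s 1 f') ∧
      (∀ i, i = a ∨ i = c ∨ i = r ∨ i = s → f' i = g i) ∧
      ∀ i, i ≠ a → i ≠ c → i ≠ r → i ≠ s → f' i = f i := by
  let f₁ : Fin n → ℤ := fun i => if i = a ∨ i = c then g i else f i
  let f₂ : Fin n → ℤ := fun i => if i = r ∨ i = s then g i else f₁ i
  have hac₀ : IsFrame a c r s f := by grind [IsFrame]
  have hac₁ : IsFrame a c r s f₁ := by grind [IsFrame]
  have hrs₁ : IsFrame r s a c f₁ := by grind [IsFrame]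
  have hro : g r % 2 = 0 ∧ g s % 2 = 0 := by grind [IsFrame]
  have hrs₂ : IsEvenFrame r s a c f₂ := by
    refine ⟨hrs₁.1, fun i => ?_⟩
    have hi := hrs₁.2.1 i
    grind
  have e1 := near_hop τ 1 hf hac₀ (by grind)
  rw [line_shift (α := a) (f := f) (f' := f₁) (by grind) (by grind)] at e1
  have e2 := near_hop 1 1 hac₁ hrs₁ (by grind)
  rw [line_shift (α := r) (f := f₁) (f' := f₂) (by grind) (by grind)] at e2
  exact ⟨f₂, hrs₂, (e1.trans e2).mono (by omega), by grind, by grind⟩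

lemma cross {a b c q r s t : Fin n} {f g : Fin n → ℤ} (ε : ℤˣ)
    (hf : IsEvenFrame c q a b f) (hg : ∀ i, g i % 2 = 1 ↔ i = a ∨ i = c)
    (hr : r ≠ a ∧ r ≠ b ∧ r ≠ c ∧ r ≠ q) (hs : s ≠ a ∧ s ≠ b ∧ s ≠ c ∧ s ≠ q ∧ s ≠ r)
    (ht : t ≠ a ∧ t ≠ b ∧ t ≠ c ∧ t ≠ q ∧ t ≠ r ∧ t ≠ s) :
    ∃ f', IsEvenFrame r s a c f' ∧ Near 7 (line c q ε f) (line r s 1 f') ∧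
      (∀ i ∈ [a, b, c, q, r, s, t], f' i = g i) ∧
      ∀ i, i ∉ [a, b, c, q, r, s, t] → f' i = f i := by
  have hd := hf.1
  obtain ⟨f₀, h0, e1, hac, ha, hb, hq, hr', hs', hoff⟩ := cross_head (g := g)
    (z := g q - (g t - f t)) ε hf (by grind) (by grind) (by grind) (by grind [IsEvenFrame]) hr hs
  let f₁ : Fin n → ℤ := fun i => if i = q ∨ i = t then g i else f₀ i
  have hqt₀ : IsFrame q t r s f₀ := by grind [IsFrame]
  have hqt₁ : IsFrame q t r s f₁ := by grind [IsFrame]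
  have e2 := near_hop (-1) 1 h0 hqt₀ (by grind)
  rw [line_shift (α := q) (f := f₀) (f' := f₁) (by grind) (by grind)] at e2
  obtain ⟨f', hf', e3, hon, hoff'⟩ := cross_tail (a := a) (c := c) (g := g) 1 hqt₁ (by grind)
    (by grind) (by grind) (by grind) (by grind) (by grind) (by grind)
  refine ⟨f', hf', ((e1.trans e2).trans e3).mono (by omega), ?_, ?_⟩
  · simp only [List.mem_cons, List.not_mem_nil, or_false]
    grind
  · simp only [List.mem_cons, List.not_mem_nil, or_false]
    grind

lemma cross_flip {a b c q r s t u : Fin n} {f g : Fin n → ℤ} (ε : ℤˣ)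
    (hf : IsEvenFrame c q a b f) (hg : ∀ i, g i % 2 = 1 ↔ i = a ∨ i = c)
    (hr : r ≠ a ∧ r ≠ b ∧ r ≠ c ∧ r ≠ q) (hs : s ≠ a ∧ s ≠ b ∧ s ≠ c ∧ s ≠ q ∧ s ≠ r)
    (ht : t ≠ a ∧ t ≠ b ∧ t ≠ c ∧ t ≠ q ∧ t ≠ r ∧ t ≠ s)
    (hu : u ≠ a ∧ u ≠ b ∧ u ≠ c ∧ u ≠ q ∧ u ≠ r ∧ u ≠ s ∧ u ≠ t) :
    ∃ f', IsEvenFrame r s a c f' ∧ Near 8 (line c q ε f) (line r s 1 f') ∧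
      ∀ i ∈ [a, b, c, q, r, s, t, u], f' i = g i := by
  have hd := hf.1
  obtain ⟨f₀, h0, e1, hac, ha, hb, hq, hr', hs', hoff⟩ := cross_head (g := g)
    (z := g q) ε hf (by grind) (by grind) (by grind) (by grind) hr hs
  let f₁ : Fin n → ℤ := fun i => if i = t ∨ i = u then g i else f₀ i
  have htu₀ : IsFrame t u r s f₀ := by grind [IsFrame]
  have htu₁ : IsFrame t u r s f₁ := by grind [IsFrame]
  have e2 := near_hop (-1) 1 h0 htu₀ (by grind)
  have e3 := near_flip (f' := f₁) 1 htu₀ htu₁ (by grind)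
  obtain ⟨f', hf', e4, hon, hoff'⟩ := cross_tail (a := a) (c := c) (g := g) (-1) htu₁ (by grind)
    (by grind) (by grind) (by grind) (by grind) (by grind) (by grind)
  refine ⟨f', hf', (((e1.trans e2).trans e3).trans e4).mono (by omega), ?_⟩
  simp only [List.mem_cons, List.not_mem_nil, or_false]
  grind

lemma near_of_cross {a b c q w : Fin n} {f g : Fin n → ℤ} (ε σ : ℤˣ)
    (hn : 7 ≤ n) (hf : IsEvenFrame c q a b f) (hg : IsEvenFrame b w a c g) :
    Near (n + 1) (line c q ε f) (line b w σ g) := by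
  obtain ⟨r, hr⟩ := exists_notMem_list [a, b, c, q, w] (by simp; omega)
  obtain ⟨s, hs⟩ := exists_notMem_list [a, b, c, q, w, r] (by simp; omega)
  simp only [List.mem_cons, List.not_mem_nil, or_false] at hr hs
  push Not at hr hs
  have hd := hf.1
  have hd' := hg.1
  by_cases hw : w = q
  · subst hw
    obtain ⟨t, ht⟩ := exists_notMem_list [a, b, c, w, r, s] (by simp; omega)
    simp only [List.mem_cons, List.not_mem_nil, or_false] at ht
    push Not at ht
    rcases Nat.even_or_odd' n with ⟨m, hm | hm⟩
    · obtain ⟨u, hu⟩ := exists_notMem_list [a, b, c, w, r, s, t] (by simp; omega)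
      simp only [List.mem_cons, List.not_mem_nil, or_false] at hu
      push Not at hu
      obtain ⟨f', hf', e1, hon⟩ := cross_flip (r := r) (s := s) ε hf hg.2 (by tauto) (by tauto) ht hu
      have e2 := near_sweep_list 1 σ [a, b, c, w, r, s, t, u] (m - 4) hf' hg
        (by grind) (by simp only [List.length_cons, List.length_nil]; omega) (by simp)
        hon (Or.inr (by grind))
      exact (e1.trans e2).mono (by omega)
    · obtain ⟨f', hf', e1, hon, -⟩ := cross (r := r) (s := s) ε hf hg.2 (by tauto) (by tauto) ht
      have e2 := near_sweep_list 1 σ [a, b, c, w, r, s, t] (m - 3) hf' hg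
        (by grind) (by simp only [List.length_cons, List.length_nil]; omega) (by simp)
        hon (Or.inr (by grind))
      exact (e1.trans e2).mono (by omega)
  · rcases Nat.even_or_odd' n with ⟨m, hm | hm⟩
    · obtain ⟨t, ht⟩ := exists_notMem_list [a, b, c, q, r, s, w] (by simp; omega)
      simp only [List.mem_cons, List.not_mem_nil, or_false] at ht
      push Not at ht
      have hgw : IsEvenFrame w b a c g := by grind [IsEvenFrame]
      obtain ⟨g', hg', hl, hgw', hoff⟩ := hgw.slide σ (z := f w) (by grind [IsEvenFrame])
      rw [line_comm b w, hl]
      obtain ⟨f', hf', e1, hon, hoff'⟩ := cross (r := r) (s := s) ε hf hg'.2 (by tauto) (by tauto)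
        (show t ≠ a ∧ t ≠ b ∧ t ≠ c ∧ t ≠ q ∧ t ≠ r ∧ t ≠ s by tauto)
      have hw' : f' w = g' w := by
        rw [hgw']
        exact hoff' w (by simp; tauto)
      have e2 := near_sweep_list 1 σ (w :: [a, b, c, q, r, s, t]) (m - 4) hf' hg'
        (by grind) (by simp only [List.length_cons, List.length_nil]; omega) (by simp)
        (by grind) (Or.inr (by grind))
      exact (e1.trans e2).mono (by omega)
    · obtain ⟨f', hf', e1, hon, -⟩ := cross (r := r) (s := s) (t := w) ε hf hg.2 (by tauto) (by tauto) (by grind)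
      have e2 := near_sweep_list 1 σ [a, b, c, q, r, s, w] (m - 3) hf' hg
        (by grind) (by simp only [List.length_cons, List.length_nil]; omega) (by simp)
        hon (Or.inr (by grind))
      exact (e1.trans e2).mono (by omega)

/-! ### The distance bound -/

lemma near_of_one_common {α β α' β' a b c : Fin n} {f g : Fin n → ℤ} (ε σ : ℤˣ)
    (hn : 7 ≤ n) (hf : IsEvenFrame α β a b f) (hg : IsEvenFrame α' β' a c g) (hbc : b ≠ c) :
    Near (n + 1) (line α β ε f) (line α' β' σ g) := by
  by_cases hc : c ≠ α ∧ c ≠ β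
  · exact near_of_exchange ε σ hn hf hg (by tauto)
  by_cases hb : b ≠ α' ∧ b ≠ β'
  · exact (near_of_exchange σ ε hn hg hf (by tauto)).symm
  have hf' : IsEvenFrame β α a b f := by grind [IsEvenFrame]
  have hg' : IsEvenFrame β' α' a c g := by grind [IsEvenFrame]
  obtain rfl | rfl : α = c ∨ β = c := by tauto
  · obtain rfl | rfl : α' = b ∨ β' = b := by tauto
    · exact near_of_cross ε σ hn hf hg
    · rw [line_comm α']
      exact near_of_cross ε σ hn hf hg'
  · rw [line_comm α]
    obtain rfl | rfl : α' = b ∨ β' = b := by tauto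
    · exact near_of_cross ε σ hn hf' hg
    · rw [line_comm α']
      exact near_of_cross ε σ hn hf' hg'

lemma near_of_isEvenFrame {α β α' β' o₁ o₂ u₁ u₂ : Fin n} {f g : Fin n → ℤ} (ε σ : ℤˣ)
    (hn : 7 ≤ n) (hf : IsEvenFrame α β o₁ o₂ f) (hg : IsEvenFrame α' β' u₁ u₂ g) :
    Near (n + 1) (line α β ε f) (line α' β' σ g) := by
  have hfs : IsEvenFrame α β o₂ o₁ f := by grind [IsEvenFrame]
  have hgs : IsEvenFrame α' β' u₂ u₁ g := by grind [IsEvenFrame]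
  have hfc : IsEvenFrame β α o₁ o₂ f := by grind [IsEvenFrame]
  have hd := hf.1
  have hd' := hg.1
  have common : ∀ {o o' u u' : Fin n}, IsEvenFrame α β o o' f → IsEvenFrame α' β' u u' g →
      u = o → Near (n + 1) (line α β ε f) (line α' β' σ g) := by
    rintro o o' _ u' h h' rfl
    by_cases he : o' = u'
    · subst he; exact near_of_same_odd ε σ hn h h'
    · exact near_of_one_common ε σ hn h h' he
  by_cases h1 : u₁ = o₁
  · exact common hf hg h1
  by_cases h2 : u₁ = o₂
  · exact common hfs hg h2
  by_cases h3 : u₂ = o₁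
  · exact common hf hgs h3
  by_cases h4 : u₂ = o₂
  · exact common hfs hgs h4
  have meets : ∀ {γ δ u u' : Fin n}, IsEvenFrame γ δ o₁ o₂ f → IsEvenFrame α' β' u u' g →
      u' ≠ o₁ ∧ u' ≠ o₂ → u = γ → Near (n + 1) (line γ δ ε f) (line α' β' σ g) := by
    rintro γ δ _ u' h h' hu rfl
    by_cases he : u' = δ
    · subst he; exact near_of_odd_eq_source ε σ hn h h'
    · exact near_of_odd_meets_source ε σ hn h h' ⟨he, hu⟩
  by_cases h5 : u₁ = α
  · exact meets hf hg ⟨h3, h4⟩ h5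
  by_cases h6 : u₁ = β
  · rw [line_comm]; exact meets hfc hg ⟨h3, h4⟩ h6
  by_cases h7 : u₂ = α
  · exact meets hf hgs ⟨h1, h2⟩ h7
  by_cases h8 : u₂ = β
  · rw [line_comm]; exact meets hfc hgs ⟨h1, h2⟩ h8
  exact near_of_odd_disjoint ε σ hn hf hg ⟨h5, h6, h1, h2⟩ ⟨h7, h8, h3, h4⟩

lemma edist_le_of_mem_lineSet (hn : 7 ≤ n) (x y : lineSet n) :
    (commGraph (lineSet n)).edist x y ≤ (n : ℕ∞) + 1 := by
  obtain ⟨x, α, β, o₁, o₂, ε, f, hf, rfl⟩ := x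
  obtain ⟨y, α', β', u₁, u₂, σ, g, hg, rfl⟩ := y
  obtain ⟨f', hf', h1⟩ := hf.exists_even ε
  obtain ⟨g', hg', h2⟩ := hg.exists_even σ
  obtain ⟨_, _, h⟩ := near_of_isEvenFrame ε σ hn hf' hg'
  simpa only [h1, h2, Nat.cast_add, Nat.cast_one] using h

end AffineWeylC

/-- For the class of labelled cycle type `(1, k_e, 2, 0)` with
`k_e ≥ 3`, the commuting involution graph is connected with diameter at most `n+1`. -/
theorem stmt_14 (n ke : ℕ) (hke : 3 ≤ ke) (hsum : 2 + ke + 2 = n)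
    (a : AffineWeylC n) (ha : a.Involution) (htype : a.HasType 1 ke 2 0)
    (X : Set (AffineWeylC n)) (hX : X = AffineWeylC.conjClass a) :
    (commGraph X).Connected ∧ (commGraph X).ediam ≤ (n : ℕ∞) + 1 := by
  have hn : 7 ≤ n := by omega
  have hmem := AffineWeylC.mem_lineSet_of_hasType hsum ha htype
  rw [AffineWeylC.conjClass_eq_lineSet hmem] at hX
  subst hX
  have hdist := AffineWeylC.edist_le_of_mem_lineSet hn
  refine ⟨?_, SimpleGraph.ediam_le_of_edist_le hdist⟩
  have : Nonempty (AffineWeylC.lineSet n) := ⟨⟨a, hmem⟩⟩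
  refine ⟨fun x y => SimpleGraph.edist_ne_top_iff_reachable.mp fun h => ?_⟩
  have hxy := hdist x y
  rw [h, top_le_iff] at hxy
  exact absurd hxy (by exact_mod_cast ENat.natCast_ne_top (n + 1))
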